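/- arXiv:0812.1685 — 7 statements merged into one kernel-verified Lean document; each statement's English description precedes it below -/
import Mathlib

section
/- Let C̲ be a G-coalgebra. The functor F : M^{G,C̲} → M^{C_e} sending a right G-C̲-comodule M̲ to the right C_e-comodule M_e (with coaction ρ_{e,e}) is left adjoint to the functor G : M^{C_e} → M^{G,C̲} sending a right C_e-comodule N to the family (N □_{C_e} C_α)_{α∈G} with structure maps induced by the maps N □_{C_e} Δ_{α,β} : N □_{C_e} C_{αβ} → (N □_{C_e} C_α) ⊗ C_β. The unit of the adjunction at M̲ is the family of corestrictions of ρ_{e,α} : M_α → M_e ⊗ C_α to M_e □_{C_e} C_α, and the counit at N is the bijection N □_{C_e} C_e → N, Σ_i n_i ⊗ c_i ↦ Σ_i ε(c_i) n_i. -/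
open TensorProduct

universe u

/-- A `G`-group coalgebra over `k`: a family of `k`-vector spaces `C α` with
comultiplications `Δ_{α,β} : C (α*β) → C α ⊗ C β` and a counit `ε : C 1 → k`.
The comultiplication takes an explicit proof `γ = α * β` to avoid dependent casts. -/
structure GCoalgebra (k : Type u) [Field k] (G : Type u) [Group G] where
  C : G → Type u
  [acg : ∀ α, AddCommGroup (C α)]
  [mod : ∀ α, Module k (C α)]
  Δ : ∀ ⦃γ⦄ (α β : G), γ = α * β → (C γ →ₗ[k] C α ⊗[k] C β)
  ε : C 1 →ₗ[k] k
  coassoc : ∀ ⦃δ δ₁ δ₂ : G⦄ (α β γ : G) (h₁ : δ = δ₁ * γ) (h₁' : δ₁ = α * β)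
      (h₂ : δ = α * δ₂) (h₂' : δ₂ = β * γ),
      (TensorProduct.assoc k (C α) (C β) (C γ)).toLinearMap ∘ₗ
        (TensorProduct.map (Δ α β h₁') LinearMap.id) ∘ₗ Δ δ₁ γ h₁
      = (TensorProduct.map LinearMap.id (Δ β γ h₂')) ∘ₗ Δ α δ₂ h₂
  counit_right : ∀ (α : G) (h : α = α * 1),
      (TensorProduct.rid k (C α)).toLinearMap ∘ₗ
        (TensorProduct.map LinearMap.id ε) ∘ₗ Δ α 1 h = LinearMap.id
  counit_left : ∀ (α : G) (h : α = 1 * α),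
      (TensorProduct.lid k (C α)).toLinearMap ∘ₗ
        (TensorProduct.map ε LinearMap.id) ∘ₗ Δ 1 α h = LinearMap.id

attribute [instance] GCoalgebra.acg GCoalgebra.mod

variable {k : Type u} [Field k] {G : Type u} [Group G]

/-- A right `G`-`C̲`-comodule. -/
structure GComodule (Cc : GCoalgebra k G) where
  M : G → Type u
  [acg : ∀ α, AddCommGroup (M α)]
  [mod : ∀ α, Module k (M α)]
  ρ : ∀ ⦃γ⦄ (α β : G), γ = α * β → (M γ →ₗ[k] M α ⊗[k] Cc.C β)
  counit : ∀ (α : G) (h : α = α * 1),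
      (TensorProduct.rid k (M α)).toLinearMap ∘ₗ
        (TensorProduct.map LinearMap.id Cc.ε) ∘ₗ ρ α 1 h = LinearMap.id
  coassoc : ∀ ⦃δ δ₁ δ₂ : G⦄ (α β γ : G) (h₁ : δ = δ₁ * γ) (h₁' : δ₁ = α * β)
      (h₂ : δ = α * δ₂) (h₂' : δ₂ = β * γ),
      (TensorProduct.assoc k (M α) (Cc.C β) (Cc.C γ)).toLinearMap ∘ₗ
        (TensorProduct.map (ρ α β h₁') LinearMap.id) ∘ₗ ρ δ₁ γ h₁
      = (TensorProduct.map LinearMap.id (Cc.Δ β γ h₂')) ∘ₗ ρ α δ₂ h₂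

attribute [instance] GComodule.acg GComodule.mod

/-- A morphism of right `G`-`C̲`-comodules. -/
structure GComodHom {Cc : GCoalgebra k G} (M N : GComodule Cc) where
  φ : ∀ α, M.M α →ₗ[k] N.M α
  colinear : ∀ ⦃γ⦄ (α β : G) (h : γ = α * β),
      (TensorProduct.map (φ α) LinearMap.id) ∘ₗ M.ρ α β h = N.ρ α β h ∘ₗ φ γ

/-- A `G`-coalgebra is strong if all comultiplication maps are injective. -/
def GCoalgebra.Strong (Cc : GCoalgebra k G) : Prop :=
  ∀ (α β : G), Function.Injective (Cc.Δ α β rfl)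
/-- The cotensor product `N □_{C_e} P` of a right `C_e`-comodule `(N, ρN)` and a left
`C_e`-comodule `(P, lamP)`: the kernel of `ρN ⊗ id - id ⊗ lamP : N ⊗ P → (N ⊗ C_e) ⊗ P`. -/
noncomputable def cotensor {k G : Type u} [Field k] [Group G] {Cc : GCoalgebra k G}
    {N P : Type u} [AddCommGroup N] [Module k N] [AddCommGroup P] [Module k P]
    (ρN : N →ₗ[k] N ⊗[k] Cc.C 1) (lamP : P →ₗ[k] Cc.C 1 ⊗[k] P) :
    Submodule k (N ⊗[k] P) :=
  LinearMap.ker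
    (TensorProduct.map ρN LinearMap.id -
      (TensorProduct.assoc k N (Cc.C 1) P).symm.toLinearMap ∘ₗ
        TensorProduct.map LinearMap.id lamP)
variable {k G : Type u} [Field k] [Group G]

/-- A right `C_e`-comodule. -/
structure CeComod (Cc : GCoalgebra k G) where
  N : Type u
  [acg : AddCommGroup N]
  [mod : Module k N]
  ρ : N →ₗ[k] N ⊗[k] Cc.C 1
  counit : (TensorProduct.rid k N).toLinearMap ∘ₗ
      TensorProduct.map LinearMap.id Cc.ε ∘ₗ ρ = LinearMap.id
  coassoc : (TensorProduct.assoc k N (Cc.C 1) (Cc.C 1)).toLinearMap ∘ₗ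
      TensorProduct.map ρ LinearMap.id ∘ₗ ρ
    = TensorProduct.map LinearMap.id (Cc.Δ 1 1 (one_mul 1).symm) ∘ₗ ρ

attribute [instance] CeComod.acg CeComod.mod

/-- A morphism of right `C_e`-comodules. -/
structure CeComodHom {Cc : GCoalgebra k G} (N N' : CeComod Cc) where
  f : N.N →ₗ[k] N'.N
  colinear : TensorProduct.map f LinearMap.id ∘ₗ N.ρ = N'.ρ ∘ₗ f

/-- The identity morphism of `C_e`-comodules. -/
def CeComodHom.idHom {Cc : GCoalgebra k G} (N : CeComod Cc) : CeComodHom N N :=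
  ⟨LinearMap.id, by rw [TensorProduct.map_id]; simp⟩

/-- Composition of morphisms of `C_e`-comodules. -/
def CeComodHom.comp {Cc : GCoalgebra k G} {N N' N'' : CeComod Cc}
    (g : CeComodHom N' N'') (f : CeComodHom N N') : CeComodHom N N'' :=
  ⟨g.f ∘ₗ f.f, by
    have hmap : TensorProduct.map (g.f ∘ₗ f.f) (LinearMap.id : Cc.C 1 →ₗ[k] Cc.C 1)
        = TensorProduct.map g.f LinearMap.id ∘ₗ TensorProduct.map f.f LinearMap.id := by
      rw [← TensorProduct.map_comp]; simp
    rw [hmap, LinearMap.comp_assoc, f.colinear, ← LinearMap.comp_assoc, g.colinear,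
      LinearMap.comp_assoc]⟩

/-- The identity morphism of `G`-`C̲`-comodules. -/
def GComodHom.idHom {Cc : GCoalgebra k G} (M : GComodule Cc) : GComodHom M M :=
  ⟨fun _ => LinearMap.id, fun γ α β h => by rw [TensorProduct.map_id]; simp⟩

/-- Composition of morphisms of `G`-`C̲`-comodules. -/
def GComodHom.comp {Cc : GCoalgebra k G} {M M' M'' : GComodule Cc}
    (g : GComodHom M' M'') (f : GComodHom M M') : GComodHom M M'' :=
  ⟨fun α => g.φ α ∘ₗ f.φ α, fun γ α β h => by
    have hmap : TensorProduct.map (g.φ α ∘ₗ f.φ α) (LinearMap.id : Cc.C β →ₗ[k] Cc.C β)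
        = TensorProduct.map (g.φ α) LinearMap.id ∘ₗ
            TensorProduct.map (f.φ α) LinearMap.id := by
      rw [← TensorProduct.map_comp]; simp
    rw [hmap, LinearMap.comp_assoc, f.colinear α β h, ← LinearMap.comp_assoc,
      g.colinear α β h, LinearMap.comp_assoc]⟩

/-- The functor `F : M^{G,C̲} → M^{C_e}` on objects: `F(M̲) = M_e` with coaction
`ρ_{e,e}`. -/
def Fdeg (Cc : GCoalgebra k G) (M : GComodule Cc) : CeComod Cc where
  N := M.M 1
  ρ := M.ρ 1 1 (one_mul 1).symm
  counit := M.counit 1 (one_mul 1).symm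
  coassoc := M.coassoc 1 1 1 (one_mul 1).symm (one_mul 1).symm
    (one_mul 1).symm (one_mul 1).symm

/-- The functor `F` on morphisms: `F(φ̲) = φ_e`. -/
def Fmor (Cc : GCoalgebra k G) {M M' : GComodule Cc} (φ : GComodHom M M') :
    CeComodHom (Fdeg Cc M) (Fdeg Cc M') :=
  ⟨φ.φ 1, φ.colinear 1 1 (one_mul 1).symm⟩

/-- The cotensor product `N □_{C_e} C_α`. -/
noncomputable def cotN {Cc : GCoalgebra k G} (N : CeComod Cc) (α : G) :
    Submodule k (N.N ⊗[k] Cc.C α) :=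
  cotensor N.ρ (Cc.Δ 1 α (one_mul α).symm)

/-- The counit `ν_N : N □_{C_e} C_e → N`, `Σᵢ nᵢ ⊗ cᵢ ↦ Σᵢ ε(cᵢ) nᵢ`. -/
noncomputable def numap {Cc : GCoalgebra k G} (N : CeComod Cc) :
    ↥(cotN N 1) →ₗ[k] N.N :=
  (TensorProduct.rid k N.N).toLinearMap ∘ₗ
    TensorProduct.map LinearMap.id Cc.ε ∘ₗ (cotN N 1).subtype

section TensorLemmas

variable {R A B C D E : Type*} [CommSemiring R] [AddCommMonoid A] [AddCommMonoid B]
  [AddCommMonoid C] [AddCommMonoid D] [AddCommMonoid E] [Module R A] [Module R B] [Module R C]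
  [Module R D] [Module R E]

theorem map_id_assoc_symm_tmul (f : C →ₗ[R] D) (a : A) (t : B ⊗[R] C) :
    TensorProduct.map LinearMap.id f ((TensorProduct.assoc R A B C).symm (a ⊗ₜ t))
      = (TensorProduct.assoc R A B D).symm (a ⊗ₜ TensorProduct.map LinearMap.id f t) := by
  induction t with
  | zero => simp
  | tmul b c => simp
  | add x y hx hy => simp [TensorProduct.tmul_add, hx, hy]

theorem map_map_id_assoc_symm_tmul (f : B →ₗ[R] D) (a : A) (t : B ⊗[R] C) :
    TensorProduct.map (TensorProduct.map LinearMap.id f) LinearMap.id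
        ((TensorProduct.assoc R A B C).symm (a ⊗ₜ t))
      = (TensorProduct.assoc R A D C).symm (a ⊗ₜ TensorProduct.map f LinearMap.id t) := by
  induction t with
  | zero => simp
  | tmul b c => simp
  | add x y hx hy => simp [TensorProduct.tmul_add, hx, hy]

theorem rid_assoc_symm_tmul (a : A) (t : B ⊗[R] R) :
    TensorProduct.rid R (A ⊗[R] B) ((TensorProduct.assoc R A B R).symm (a ⊗ₜ t))
      = a ⊗ₜ TensorProduct.rid R B t := by
  induction t with
  | zero => simp
  | tmul b c => simp
  | add x y hx hy => simp [TensorProduct.tmul_add, hx, hy]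

theorem map_rid_assoc_symm_tmul (a : A) (t : R ⊗[R] B) :
    TensorProduct.map (TensorProduct.rid R A).toLinearMap LinearMap.id
        ((TensorProduct.assoc R A R B).symm (a ⊗ₜ t))
      = a ⊗ₜ TensorProduct.lid R B t := by
  induction t with
  | zero => simp
  | tmul b c => simp [TensorProduct.smul_tmul]
  | add x y hx hy => simp [TensorProduct.tmul_add, hx, hy]

theorem assoc_symm_assoc_symm_tmul (a : A) (u : (B ⊗[R] C) ⊗[R] D) :
    (TensorProduct.assoc R (A ⊗[R] B) C D).symm
        ((TensorProduct.assoc R A B (C ⊗[R] D)).symm (a ⊗ₜ TensorProduct.assoc R B C D u))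
      = TensorProduct.map (TensorProduct.assoc R A B C).symm.toLinearMap LinearMap.id
          ((TensorProduct.assoc R A (B ⊗[R] C) D).symm (a ⊗ₜ u)) := by
  induction u with
  | zero => simp
  | tmul t d =>
    induction t with
    | zero => simp
    | tmul b c => simp
    | add x y hx hy =>
      simp only [TensorProduct.add_tmul, TensorProduct.tmul_add, map_add, hx, hy]
  | add x y hx hy => simp only [TensorProduct.tmul_add, map_add, hx, hy]

theorem map_id_assoc_symm (f : A →ₗ[R] E) (x : A ⊗[R] (B ⊗[R] C)) :
    TensorProduct.map (TensorProduct.map f LinearMap.id) LinearMap.id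
        ((TensorProduct.assoc R A B C).symm x)
      = (TensorProduct.assoc R E B C).symm (TensorProduct.map f LinearMap.id x) := by
  rw [TensorProduct.map_map_assoc_symm, TensorProduct.map_id]

theorem map_id_assoc (f : A →ₗ[R] E) (x : (A ⊗[R] B) ⊗[R] C) :
    TensorProduct.map f LinearMap.id (TensorProduct.assoc R A B C x)
      = TensorProduct.assoc R E B C
          (TensorProduct.map (TensorProduct.map f LinearMap.id) LinearMap.id x) := by
  rw [← TensorProduct.map_map_assoc, TensorProduct.map_id]

theorem map_id_map_id_comm (f : A →ₗ[R] B) (g : C →ₗ[R] D) (x : A ⊗[R] C) :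
    TensorProduct.map f LinearMap.id (TensorProduct.map LinearMap.id g x)
      = TensorProduct.map LinearMap.id g (TensorProduct.map f LinearMap.id x) := by
  induction x with
  | zero => simp
  | add x y hx hy => simp only [map_add, hx, hy]
  | tmul a c => simp

theorem map_rid (f : A →ₗ[R] B) (x : A ⊗[R] R) :
    f (TensorProduct.rid R A x)
      = TensorProduct.rid R B (TensorProduct.map f LinearMap.id x) := by
  induction x with
  | zero => simp
  | add x y hx hy => simp only [map_add, hx, hy]
  | tmul a c => simp

theorem map_comp_id_apply (g : B →ₗ[R] D) (f : A →ₗ[R] B) (x : A ⊗[R] C) :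
    TensorProduct.map (g ∘ₗ f) LinearMap.id x
      = TensorProduct.map g LinearMap.id (TensorProduct.map f LinearMap.id x) := by
  induction x with
  | zero => simp
  | add x y hx hy => simp only [map_add, hx, hy]
  | tmul a c => simp

end TensorLemmas

theorem map_subtype_id_injective {A C : Type*} [AddCommGroup A] [AddCommGroup C]
    [Module k A] [Module k C] (p : Submodule k A) :
    Function.Injective
      (TensorProduct.map p.subtype (LinearMap.id : C →ₗ[k] C)) :=
  Module.Flat.rTensor_preserves_injective_linearMap _ p.injective_subtype

theorem exists_map_subtype_ker_sub {A B C : Type*} [AddCommGroup A] [AddCommGroup B]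
    [AddCommGroup C] [Module k A] [Module k B] [Module k C] (f g : A →ₗ[k] B) (x : A ⊗[k] C)
    (hx : TensorProduct.map f LinearMap.id x = TensorProduct.map g LinearMap.id x) :
    ∃ y, TensorProduct.map (LinearMap.ker (f - g)).subtype LinearMap.id y = x := by
  refine ((Module.Flat.rTensor_exact C (LinearMap.exact_subtype_ker_map (f - g))) x).1 ?_
  rw [LinearMap.rTensor_sub, LinearMap.sub_apply, sub_eq_zero]
  exact hx

variable {Cc : GCoalgebra k G}

theorem mem_cotN {N : CeComod Cc} {α : G} {x : N.N ⊗[k] Cc.C α} :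
    x ∈ cotN N α ↔ TensorProduct.map N.ρ LinearMap.id x
      = (TensorProduct.assoc k N.N (Cc.C 1) (Cc.C α)).symm
          (TensorProduct.map LinearMap.id (Cc.Δ 1 α (one_mul α).symm) x) := by
  simp [cotN, cotensor, sub_eq_zero]

/-- The map `id ⊗ Δ_{α,β} : X ⊗ C_{αβ} → (X ⊗ C_α) ⊗ C_β`. -/
noncomputable def tensorΔ (Cc : GCoalgebra k G) (X : Type u) [AddCommGroup X] [Module k X]
    {γ : G} (α β : G) (h : γ = α * β) :
    X ⊗[k] Cc.C γ →ₗ[k] (X ⊗[k] Cc.C α) ⊗[k] Cc.C β :=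
  (TensorProduct.assoc k X (Cc.C α) (Cc.C β)).symm.toLinearMap ∘ₗ
    LinearMap.lTensor X (Cc.Δ α β h)

section tensorΔ

variable {X Y : Type u} [AddCommGroup X] [Module k X] [AddCommGroup Y] [Module k Y]

theorem tensorΔ_tmul {γ : G} (α β : G) (h : γ = α * β) (a : X) (c : Cc.C γ) :
    tensorΔ Cc X α β h (a ⊗ₜ c)
      = (TensorProduct.assoc k X (Cc.C α) (Cc.C β)).symm (a ⊗ₜ Cc.Δ α β h c) := by
  simp [tensorΔ]

theorem tensorΔ_coassoc {δ δ₁ δ₂ : G} (α β γ : G) (h₁ : δ = δ₁ * γ) (h₁' : δ₁ = α * β)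
    (h₂ : δ = α * δ₂) (h₂' : δ₂ = β * γ) (x : X ⊗[k] Cc.C δ) :
    TensorProduct.map (tensorΔ Cc X α β h₁') LinearMap.id (tensorΔ Cc X δ₁ γ h₁ x)
      = tensorΔ Cc (X ⊗[k] Cc.C α) β γ h₂' (tensorΔ Cc X α δ₂ h₂ x) := by
  induction x with
  | zero => simp
  | add x y hx hy => simp only [map_add, hx, hy]
  | tmul a c =>
    have hc := LinearMap.congr_fun (Cc.coassoc α β γ h₁ h₁' h₂ h₂') c
    simp only [LinearMap.comp_apply, LinearEquiv.coe_coe] at hc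
    rw [tensorΔ_tmul, tensorΔ_tmul]
    simp only [tensorΔ, LinearMap.lTensor, LinearMap.comp_apply, LinearEquiv.coe_coe,
      map_comp_id_apply]
    rw [map_map_id_assoc_symm_tmul, map_id_assoc_symm_tmul, ← hc, assoc_symm_assoc_symm_tmul]

theorem tensorΔ_counit_right (α : G) (h : α = α * 1) (x : X ⊗[k] Cc.C α) :
    TensorProduct.rid k (X ⊗[k] Cc.C α)
      (TensorProduct.map LinearMap.id Cc.ε (tensorΔ Cc X α 1 h x)) = x := by
  induction x with
  | zero => simp
  | add x y hx hy => simp only [map_add, hx, hy]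
  | tmul a c =>
    have hc := LinearMap.congr_fun (Cc.counit_right α h) c
    simp only [LinearMap.comp_apply, LinearEquiv.coe_coe, LinearMap.id_apply] at hc
    rw [tensorΔ_tmul, map_id_assoc_symm_tmul, rid_assoc_symm_tmul, hc]

theorem tensorΔ_counit_left (α : G) (h : α = 1 * α) (x : X ⊗[k] Cc.C α) :
    TensorProduct.map ((TensorProduct.rid k X).toLinearMap ∘ₗ TensorProduct.map LinearMap.id Cc.ε)
      LinearMap.id (tensorΔ Cc X 1 α h x) = x := by
  induction x with
  | zero => simp
  | add x y hx hy => simp only [map_add, hx, hy]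
  | tmul a c =>
    have hc := LinearMap.congr_fun (Cc.counit_left α h) c
    simp only [LinearMap.comp_apply, LinearEquiv.coe_coe, LinearMap.id_apply] at hc
    rw [tensorΔ_tmul, map_comp_id_apply, map_map_id_assoc_symm_tmul, map_rid_assoc_symm_tmul, hc]

theorem tensorΔ_naturality {γ : G} (α β : G) (h : γ = α * β) (f : X →ₗ[k] Y)
    (x : X ⊗[k] Cc.C γ) :
    TensorProduct.map (TensorProduct.map f LinearMap.id) LinearMap.id (tensorΔ Cc X α β h x)
      = tensorΔ Cc Y α β h (TensorProduct.map f LinearMap.id x) := by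
  simp only [tensorΔ, LinearMap.lTensor, LinearMap.comp_apply, LinearEquiv.coe_coe,
    map_id_assoc_symm, map_id_map_id_comm]

end tensorΔ

theorem mem_cotN_iff_tensorΔ {N : CeComod Cc} {α : G} {x : N.N ⊗[k] Cc.C α} :
    x ∈ cotN N α ↔ TensorProduct.map N.ρ LinearMap.id x
      = tensorΔ Cc N.N 1 α (one_mul α).symm x :=
  mem_cotN

theorem exists_map_subtype_cotN (N : CeComod Cc) {γ : G} (α β : G) (h : γ = α * β)
    (x : cotN N γ) :
    ∃ y, TensorProduct.map (cotN N α).subtype LinearMap.id y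
      = tensorΔ Cc N.N α β h (x : N.N ⊗[k] Cc.C γ) := by
  refine exists_map_subtype_ker_sub _ _ _ ?_
  have hx := mem_cotN_iff_tensorΔ.1 x.2
  have h1 := tensorΔ_naturality α β h N.ρ (x : N.N ⊗[k] Cc.C γ)
  rw [hx, ← tensorΔ_coassoc (X := N.N) 1 α β h (one_mul α).symm (one_mul γ).symm h] at h1
  exact h1

/-- The structure map `N □ C_{αβ} → (N □ C_α) ⊗ C_β` induced by `N □ Δ_{α,β}`. -/
noncomputable def cotNCoaction (N : CeComod Cc) {γ : G} (α β : G) (h : γ = α * β) :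
    cotN N γ →ₗ[k] cotN N α ⊗[k] Cc.C β :=
  LinearMap.codRestrictOfInjective (tensorΔ Cc N.N α β h ∘ₗ (cotN N γ).subtype)
    (TensorProduct.map (cotN N α).subtype LinearMap.id) (map_subtype_id_injective _)
    (exists_map_subtype_cotN N α β h)

theorem map_subtype_cotNCoaction (N : CeComod Cc) {γ : G} (α β : G) (h : γ = α * β)
    (x : cotN N γ) :
    TensorProduct.map (cotN N α).subtype LinearMap.id (cotNCoaction N α β h x)
      = tensorΔ Cc N.N α β h (x : N.N ⊗[k] Cc.C γ) :=
  LinearMap.codRestrictOfInjective_comp_apply ..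

/-- The functor `G : M^{C_e} → M^{G,C̲}` on objects: `N ↦ (N □_{C_e} C_α)_α`. -/
noncomputable def cotensorObj (N : CeComod Cc) : GComodule Cc where
  M α := cotN N α
  ρ _ α β h := cotNCoaction N α β h
  counit α h := by
    ext1 x
    apply (cotN N α).injective_subtype
    simp only [LinearMap.comp_apply, LinearEquiv.coe_coe, LinearMap.id_apply]
    rw [map_rid, map_id_map_id_comm, map_subtype_cotNCoaction, tensorΔ_counit_right]
    rfl
  coassoc δ δ₁ δ₂ α β γ h₁ h₁' h₂ h₂' := by
    ext1 x
    apply map_subtype_id_injective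
    simp only [LinearMap.comp_apply, LinearEquiv.coe_coe]
    rw [map_id_map_id_comm, map_subtype_cotNCoaction, map_id_assoc, ← map_comp_id_apply]
    have hc : TensorProduct.map (cotN N α).subtype LinearMap.id ∘ₗ cotNCoaction N α β h₁'
        = tensorΔ Cc N.N α β h₁' ∘ₗ (cotN N δ₁).subtype :=
      LinearMap.ext (map_subtype_cotNCoaction N α β h₁')
    rw [hc, map_comp_id_apply, map_subtype_cotNCoaction,
      tensorΔ_coassoc α β γ h₁ h₁' h₂ h₂']
    exact LinearEquiv.apply_symm_apply _ _

theorem map_mem_cotN {N N' : CeComod Cc} (g : CeComodHom N N') {α : G}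
    {x : N.N ⊗[k] Cc.C α} (hx : x ∈ cotN N α) :
    TensorProduct.map g.f LinearMap.id x ∈ cotN N' α := by
  rw [mem_cotN_iff_tensorΔ] at hx ⊢
  rw [← tensorΔ_naturality, ← hx, ← map_comp_id_apply, ← map_comp_id_apply, g.colinear]

/-- The map `g □ C_α : N □ C_α → N' □ C_α` induced by a morphism `g : N → N'`. -/
noncomputable def cotNMap {N N' : CeComod Cc} (g : CeComodHom N N') (α : G) :
    cotN N α →ₗ[k] cotN N' α :=
  (TensorProduct.map g.f LinearMap.id).restrict fun _ hx => map_mem_cotN g hx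

theorem GComodHom.ext {M M' : GComodule Cc} {φ ψ : GComodHom M M'} (h : φ.φ = ψ.φ) :
    φ = ψ := by
  cases φ
  cases ψ
  cases h
  rfl

/-- The functor `G : M^{C_e} → M^{G,C̲}` on morphisms: `g ↦ (g □ C_α)_α`. -/
noncomputable def cotensorMap {N N' : CeComod Cc} (g : CeComodHom N N') :
    GComodHom (cotensorObj N) (cotensorObj N') where
  φ α := cotNMap g α
  colinear γ α β h := by
    refine LinearMap.ext fun (x : cotN N γ) => ?_
    apply map_subtype_id_injective
    change TensorProduct.map (cotN N' α).subtype LinearMap.id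
      (TensorProduct.map (cotNMap g α) LinearMap.id (cotNCoaction N α β h x))
      = TensorProduct.map (cotN N' α).subtype LinearMap.id
        (cotNCoaction N' α β h (cotNMap g γ x))
    have hg : (cotN N' α).subtype ∘ₗ cotNMap g α
        = TensorProduct.map g.f LinearMap.id ∘ₗ (cotN N α).subtype := rfl
    rw [← map_comp_id_apply, hg, map_comp_id_apply, map_subtype_cotNCoaction,
      map_subtype_cotNCoaction, tensorΔ_naturality]
    rfl

theorem GComodule.map_ρ (M : GComodule Cc) {δ δ₁ δ₂ : G} (α β γ : G) (h₁ : δ = δ₁ * γ)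
    (h₁' : δ₁ = α * β) (h₂ : δ = α * δ₂) (h₂' : δ₂ = β * γ) (m : M.M δ) :
    TensorProduct.map (M.ρ α β h₁') LinearMap.id (M.ρ δ₁ γ h₁ m)
      = tensorΔ Cc (M.M α) β γ h₂' (M.ρ α δ₂ h₂ m) := by
  have hm := LinearMap.congr_fun (M.coassoc α β γ h₁ h₁' h₂ h₂') m
  exact (LinearEquiv.eq_symm_apply _).2 hm

/-- The corestriction of `ρ_{e,α} : M_α → M_e ⊗ C_α` to `M_e □_{C_e} C_α`. -/
noncomputable def unitComponent (M : GComodule Cc) (α : G) :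
    M.M α →ₗ[k] cotN (Fdeg Cc M) α :=
  (M.ρ 1 α (one_mul α).symm).codRestrict (cotN (Fdeg Cc M) α) fun m =>
    mem_cotN_iff_tensorΔ.2 <| M.map_ρ 1 1 α (one_mul α).symm (one_mul 1).symm
      (one_mul α).symm (one_mul α).symm m

/-- The unit of the adjunction. -/
noncomputable def cotensorUnit (M : GComodule Cc) :
    GComodHom M (cotensorObj (Fdeg Cc M)) where
  φ α := unitComponent M α
  colinear γ α β h := by
    ext1 m
    apply map_subtype_id_injective
    change TensorProduct.map (cotN (Fdeg Cc M) α).subtype LinearMap.id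
      (TensorProduct.map (unitComponent M α) LinearMap.id (M.ρ α β h m))
      = TensorProduct.map (cotN (Fdeg Cc M) α).subtype LinearMap.id
        (cotNCoaction (Fdeg Cc M) α β h (unitComponent M γ m))
    rw [← map_comp_id_apply, map_subtype_cotNCoaction]
    exact M.map_ρ 1 α β h (one_mul α).symm (one_mul γ).symm h m

theorem map_numap_cotNCoaction (N : CeComod Cc) (α : G) (h : α = 1 * α) (x : cotN N α) :
    TensorProduct.map (numap N) LinearMap.id (cotNCoaction N 1 α h x)
      = (x : N.N ⊗[k] Cc.C α) := by
  rw [numap, ← LinearMap.comp_assoc, map_comp_id_apply, map_subtype_cotNCoaction,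
    tensorΔ_counit_left]

theorem ρ_numap (N : CeComod Cc) (x : cotN N 1) : N.ρ (numap N x) = x := by
  have hx := mem_cotN_iff_tensorΔ.1 x.2
  simp only [numap, LinearMap.comp_apply, LinearEquiv.coe_coe]
  rw [map_rid, map_id_map_id_comm]
  exact (congrArg _ (congrArg _ hx)).trans (tensorΔ_counit_right 1 (mul_one 1).symm _)

theorem numap_bijective (N : CeComod Cc) : Function.Bijective (numap N) := by
  have hρ (n : N.N) : N.ρ n ∈ cotN N 1 :=
    mem_cotN_iff_tensorΔ.2
      ((LinearEquiv.eq_symm_apply _).2 (LinearMap.congr_fun N.coassoc n))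
  refine ⟨fun x y hxy => Subtype.ext ?_, fun n => ⟨⟨N.ρ n, hρ n⟩, ?_⟩⟩
  · rw [← ρ_numap, hxy, ρ_numap]
  · exact LinearMap.congr_fun N.counit n

theorem numap_cotNMap {N N' : CeComod Cc} (g : CeComodHom N N') (x : cotN N 1) :
    numap N' (cotNMap g 1 x) = g.f (numap N x) := by
  simp only [numap, LinearMap.comp_apply, LinearEquiv.coe_coe]
  rw [map_rid, map_id_map_id_comm]
  rfl

theorem cotNMap_id (N : CeComod Cc) (α : G) :
    cotNMap (CeComodHom.idHom N) α = LinearMap.id :=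
  LinearMap.ext fun x => Subtype.ext <|
    LinearMap.congr_fun (TensorProduct.map_id (R := k) (M := N.N) (N := Cc.C α)) x

theorem cotNMap_comp {N N' N'' : CeComod Cc} (g : CeComodHom N' N'') (f : CeComodHom N N')
    (α : G) : cotNMap (g.comp f) α = cotNMap g α ∘ₗ cotNMap f α :=
  LinearMap.ext fun x => Subtype.ext (map_comp_id_apply g.f f.f x.1)

/-- **Proposition 1.1.** `(F, G)` is a pair of adjoint functors between `M^{G,C̲}` and
`M^{C_e}`, where `F(M̲) = M_e` and `G(N) = (N □_{C_e} C_α)_α` with structure maps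
induced by `N □ Δ_{α,β}`; the unit at `M̲` is the family of corestrictions of
`ρ_{e,α} : M_α → M_e ⊗ C_α` to `M_e □_{C_e} C_α`, and the counit at `N` is the
bijection `N □_{C_e} C_e → N`, `Σᵢ nᵢ ⊗ cᵢ ↦ Σᵢ ε(cᵢ) nᵢ`. -/
theorem F_adjoint_G (Cc : GCoalgebra k G) :
    ∃ (Gob : CeComod Cc → GComodule Cc)
      (eiso : ∀ (N : CeComod Cc) (α : G), (Gob N).M α ≃ₗ[k] ↥(cotN N α))
      (Gmor : ∀ {N N' : CeComod Cc},
        CeComodHom N N' → GComodHom (Gob N) (Gob N'))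
      (η : ∀ M : GComodule Cc, GComodHom M (Gob (Fdeg Cc M))),
      -- (a) the components of `G(N)` are the cotensor products `N □_{C_e} C_α`, and
      -- its structure maps are induced by `N □ Δ_{α,β}`
      (∀ (N : CeComod Cc) ⦃γ : G⦄ (α β : G) (h : γ = α * β),
        TensorProduct.map ((cotN N α).subtype ∘ₗ (eiso N α).toLinearMap)
            LinearMap.id ∘ₗ (Gob N).ρ α β h
          = (TensorProduct.assoc k N.N (Cc.C α) (Cc.C β)).symm.toLinearMap ∘ₗ
              LinearMap.lTensor N.N (Cc.Δ α β h) ∘ₗ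
              (cotN N γ).subtype ∘ₗ (eiso N γ).toLinearMap) ∧
      -- (b) `G` acts on a morphism `g` as `g □ C_α`, functorially
      (∀ (N N' : CeComod Cc) (g : CeComodHom N N') (α : G),
        (cotN N' α).subtype ∘ₗ (eiso N' α).toLinearMap ∘ₗ (Gmor g).φ α
          = TensorProduct.map g.f LinearMap.id ∘ₗ
              (cotN N α).subtype ∘ₗ (eiso N α).toLinearMap) ∧
      (∀ N : CeComod Cc, Gmor (CeComodHom.idHom N) = GComodHom.idHom (Gob N)) ∧
      (∀ (N N' N'' : CeComod Cc) (g : CeComodHom N' N'') (f : CeComodHom N N'),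
        Gmor (g.comp f) = (Gmor g).comp (Gmor f)) ∧
      -- (c) the unit at `M̲` is the family of corestrictions of `ρ_{e,α}`, natural
      (∀ (M : GComodule Cc) (α : G) (m : M.M α),
        (cotN (Fdeg Cc M) α).subtype ((eiso (Fdeg Cc M) α) ((η M).φ α m))
          = M.ρ 1 α (one_mul α).symm m) ∧
      (∀ (M M' : GComodule Cc) (φ : GComodHom M M') (α : G) (m : M.M α),
        (η M').φ α (φ.φ α m) = (Gmor (Fmor Cc φ)).φ α ((η M).φ α m)) ∧
      -- (d) the counit at `N` is the bijection `ν_N`, colinear and natural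
      (∀ N : CeComod Cc,
        Function.Bijective (numap N ∘ₗ (eiso N 1).toLinearMap)) ∧
      (∀ N : CeComod Cc,
        TensorProduct.map (numap N ∘ₗ (eiso N 1).toLinearMap) LinearMap.id ∘ₗ
            (Fdeg Cc (Gob N)).ρ
          = N.ρ ∘ₗ (numap N ∘ₗ (eiso N 1).toLinearMap)) ∧
      (∀ (N N' : CeComod Cc) (g : CeComodHom N N'),
        (numap N' ∘ₗ (eiso N' 1).toLinearMap) ∘ₗ (Gmor g).φ 1
          = g.f ∘ₗ (numap N ∘ₗ (eiso N 1).toLinearMap)) ∧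
      -- (e) the triangle identities
      (∀ M : GComodule Cc,
        (numap (Fdeg Cc M) ∘ₗ (eiso (Fdeg Cc M) 1).toLinearMap) ∘ₗ (η M).φ 1
          = LinearMap.id) ∧
      (∀ (N : CeComod Cc) (α : G) (x : (Gob N).M α),
        TensorProduct.map (numap N ∘ₗ (eiso N 1).toLinearMap) LinearMap.id
            ((cotN (Fdeg Cc (Gob N)) α).subtype
              ((eiso (Fdeg Cc (Gob N)) α) ((η (Gob N)).φ α x)))
          = (cotN N α).subtype ((eiso N α) x)) := by
  refine ⟨cotensorObj, fun N α => LinearEquiv.refl k (cotN N α), cotensorMap, cotensorUnit,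
    ?_, ?_, ?_, ?_, ?_, ?_, ?_, ?_, ?_, ?_, ?_⟩
  · exact fun N γ α β h => LinearMap.ext (map_subtype_cotNCoaction N α β h)
  · exact fun N N' g α => rfl
  · exact fun N => GComodHom.ext (funext (cotNMap_id N))
  · exact fun N N' N'' g f => GComodHom.ext (funext (cotNMap_comp g f))
  · exact fun M α m => rfl
  · exact fun M M' φ α m => Subtype.ext
      (LinearMap.congr_fun (φ.colinear 1 α (one_mul α).symm) m).symm
  · exact numap_bijective
  · exact fun N => LinearMap.ext fun x =>
      (map_numap_cotNCoaction N 1 (one_mul 1).symm x).trans (ρ_numap N x).symm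
  · exact fun N N' g => LinearMap.ext (numap_cotNMap g)
  · exact fun M => M.counit 1 (one_mul 1).symm
  · exact fun N α x => map_numap_cotNCoaction N α (one_mul α).symm x
end

section
/- Let C̲ be a G-coalgebra. The following assertions are equivalent: (1) Δ_{α,β} : C_{αβ} → C_α ⊗ C_β is injective for all α,β ∈ G (i.e. C̲ is strong); (2) Δ_{α,α⁻¹} : C_e → C_α ⊗ C_{α⁻¹} is injective for all α ∈ G; (3) for every right G-C̲-comodule M̲ and all α,β ∈ G, the structure map ρ^M̲_{α,β} : M_{αβ} → M_α ⊗ C_β is injective. -/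
open TensorProduct

universe u

variable {k : Type u} [Field k] {G : Type u} [Group G]

/-- A `G`-coalgebra regarded as a right comodule over itself. -/
def GCoalgebra.regularComodule (Cc : GCoalgebra k G) : GComodule Cc where
  M := Cc.C
  ρ := Cc.Δ
  counit := Cc.counit_right
  coassoc := Cc.coassoc

theorem GComodule.ρ_one_injective {Cc : GCoalgebra k G} (M : GComodule Cc) (α : G)
    (h : α = α * 1) : Function.Injective (M.ρ α 1 h) := by
  refine Function.LeftInverse.injective
    (g := fun x => TensorProduct.rid k (M.M α) (TensorProduct.map LinearMap.id Cc.ε x)) ?_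
  intro x
  exact LinearMap.congr_fun (M.counit α h) x

theorem GComodule.ρ_injective_of_Δ_injective {Cc : GCoalgebra k G} (M : GComodule Cc)
    {γ α β β' : G} (h : γ = α * β) (hβ : 1 = β' * β)
    (hΔ : Function.Injective (Cc.Δ β' β hβ)) : Function.Injective (M.ρ α β h) := by
  have hα : α = γ * β' := by
    rw [h, mul_assoc, ← inv_eq_of_mul_eq_one_left hβ.symm, mul_inv_cancel, mul_one]
  have key := M.coassoc γ β' β h hα (mul_one γ).symm hβ
  have hmap : Function.Injective
      (TensorProduct.map (LinearMap.id : M.M γ →ₗ[k] M.M γ) (Cc.Δ β' β hβ)) :=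
    Module.Flat.lTensor_preserves_injective_linearMap _ hΔ
  have hcomp := hmap.comp (M.ρ_one_injective γ (mul_one γ).symm)
  rw [← LinearMap.coe_comp, ← key, ← LinearMap.comp_assoc, LinearMap.coe_comp] at hcomp
  exact hcomp.of_comp

/-- **Proposition 1.3.** For a `G`-coalgebra `C̲` the following are equivalent:
(1) `C̲` is strong, i.e. every `Δ_{α,β} : C_{αβ} → C_α ⊗ C_β` is injective;
(2) every `Δ_{α,α⁻¹} : C_e → C_α ⊗ C_{α⁻¹}` is injective;
(3) for every right `G`-`C̲`-comodule `M̲` and all `α β`, `ρ_{α,β}` is injective. -/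
theorem strong_tfae (Cc : GCoalgebra k G) :
    List.TFAE
      [ ∀ (α β : G), Function.Injective (Cc.Δ α β rfl),
        ∀ (α : G), Function.Injective (Cc.Δ α α⁻¹ (mul_inv_cancel α).symm),
        ∀ (M : GComodule Cc) ⦃γ : G⦄ (α β : G) (h : γ = α * β),
          Function.Injective (M.ρ α β h) ] := by
  tfae_have 1 → 2 := by
    intro H α
    have general : ∀ {γ : G} (β : G) (h : γ = α * β), Function.Injective (Cc.Δ α β h) := by
      rintro _ β rfl
      exact H α β
    exact general _ _
  tfae_have 2 → 3 := by
    intro H M γ α β h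
    have general : ∀ (β' : G), β' = β⁻¹⁻¹ → ∀ hβ : 1 = β⁻¹ * β',
        Function.Injective (Cc.Δ β⁻¹ β' hβ) := by
      rintro _ rfl _
      exact H β⁻¹
    exact M.ρ_injective_of_Δ_injective h (inv_mul_cancel β).symm
      (general β (inv_inv β).symm _)
  tfae_have 3 → 1 := fun H α β => H Cc.regularComodule α β rfl
  tfae_finish
end

section
/- Let C̲ be a strong G-coalgebra and M̲ a right G-C̲-comodule. Then M_α = 0 for all α ∈ G if and only if M_α = 0 for some α ∈ G. -/
open TensorProduct

universe u

variable {k : Type u} [Field k] {G : Type u} [Group G]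

theorem GCoalgebra.Strong.injective {Cc : GCoalgebra k G} (hCc : Cc.Strong) {γ : G} (α β : G)
    (h : γ = α * β) : Function.Injective (Cc.Δ α β h) := by
  subst h
  exact hCc α β

/-- **Proposition 1.4.** Let `C̲` be a strong `G`-coalgebra and `M̲` a right
`G`-`C̲`-comodule. Then `M_α = 0` for all `α` iff `M_α = 0` for some `α`. -/
theorem strong_comodule_zero_iff (Cc : GCoalgebra k G) (hCc : Cc.Strong)
    (M : GComodule Cc) :
    (∀ α : G, ∀ m : M.M α, m = 0) ↔ (∃ α : G, ∀ m : M.M α, m = 0) := by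
  refine ⟨fun h => ⟨1, h 1⟩, ?_⟩
  rintro ⟨α, hα⟩ β m
  have : Subsingleton (M.M α) := ⟨fun x y => (hα x).trans (hα y).symm⟩
  have hρ : Function.Injective (M.ρ β 1 (mul_one β).symm) := M.ρ_one_injective β _
  have hΔ : Function.Injective (TensorProduct.map (LinearMap.id : M.M β →ₗ[k] M.M β)
      (Cc.Δ (γ := 1) (β⁻¹ * α) (α⁻¹ * β) (by group))) :=
    Module.Flat.lTensor_preserves_injective_linearMap _ (hCc.injective _ _ _)
  have hco := M.coassoc (δ := β) (δ₁ := α) (δ₂ := 1) β (β⁻¹ * α) (α⁻¹ * β)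
    (by group) (by group) (mul_one β).symm (by group)
  apply hρ
  apply hΔ
  have hm := LinearMap.congr_fun hco m
  have hz : M.ρ α (α⁻¹ * β) (by group : β = α * (α⁻¹ * β)) m = 0 := Subsingleton.elim _ _
  simp only [LinearMap.comp_apply, hz, map_zero] at hm
  rw [map_zero, map_zero]
  exact hm.symm
end

section
/- Let C̲ be a strong G-coalgebra and φ̲ : M̲ → N̲ a morphism of right G-C̲-comodules. Then: (1) φ_α is injective for all α ∈ G if and only if φ_α is injective for some α ∈ G; (2) φ_α is surjective for all α ∈ G if and only if φ_α is surjective for some α ∈ G; (3) φ_α is bijective for all α ∈ G if and only if φ_α is bijective for some α ∈ G. -/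
open TensorProduct

universe u

variable {k : Type u} [Field k] {G : Type u} [Group G]

namespace GComodule

variable {Cc : GCoalgebra k G}

theorem ρ_one_injective_s3 (M : GComodule Cc) (α : G) (h : α = α * 1) :
    Function.Injective (M.ρ α 1 h) := by
  have hid : Function.Injective (LinearMap.id : M.M α →ₗ[k] M.M α) := Function.injective_id
  rw [← M.counit α h, ← LinearMap.comp_assoc, LinearMap.coe_comp] at hid
  exact hid.of_comp

/-- All coactions of a comodule over a strong `G`-coalgebra are injective. -/
theorem ρ_injective (hCc : Cc.Strong) (M : GComodule Cc) {γ : G} (α β : G) (h : γ = α * β) :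
    Function.Injective (M.ρ α β h) := by
  have hβ : (1 : G) = β⁻¹ * β := (inv_mul_cancel β).symm
  have hco := M.coassoc γ β⁻¹ β h (by simp [h]) (mul_one γ).symm hβ
  have hΔ : Function.Injective (TensorProduct.map (LinearMap.id : M.M γ →ₗ[k] M.M γ)
      (Cc.Δ β⁻¹ β hβ)) :=
    Module.Flat.lTensor_preserves_injective_linearMap (M := M.M γ) _ (hCc.injective β⁻¹ β hβ)
  have hinj := hΔ.comp (M.ρ_one_injective_s3 γ (mul_one γ).symm)
  rw [← LinearMap.coe_comp, ← hco, ← LinearMap.comp_assoc, LinearMap.coe_comp] at hinj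
  exact hinj.of_comp

end GComodule

namespace GComodHom

variable {Cc : GCoalgebra k G} {M N : GComodule Cc}

/-- The coaction induced on the componentwise cokernel of a comodule morphism. -/
noncomputable def cokerρ (φ : GComodHom M N) ⦃γ : G⦄ (α β : G) (h : γ = α * β) :
    (N.M γ ⧸ LinearMap.range (φ.φ γ)) →ₗ[k]
      (N.M α ⧸ LinearMap.range (φ.φ α)) ⊗[k] Cc.C β :=
  (LinearMap.range (φ.φ γ)).liftQ
    (TensorProduct.map (LinearMap.range (φ.φ α)).mkQ LinearMap.id ∘ₗ N.ρ α β h) <| by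
      rw [LinearMap.range_le_ker_iff, LinearMap.comp_assoc, ← φ.colinear α β h,
        ← LinearMap.comp_assoc, ← TensorProduct.map_comp, LinearMap.range_mkQ_comp,
        TensorProduct.map_zero_left, LinearMap.zero_comp]

theorem cokerρ_comp_mkQ (φ : GComodHom M N) ⦃γ : G⦄ (α β : G) (h : γ = α * β) :
    φ.cokerρ α β h ∘ₗ (LinearMap.range (φ.φ γ)).mkQ =
      TensorProduct.map (LinearMap.range (φ.φ α)).mkQ LinearMap.id ∘ₗ N.ρ α β h :=
  Submodule.liftQ_mkQ _ _ _

/-- The cokernel of a morphism of comodules. -/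
noncomputable def coker (φ : GComodHom M N) : GComodule Cc where
  M α := N.M α ⧸ LinearMap.range (φ.φ α)
  ρ := φ.cokerρ
  counit α h := by
    apply Submodule.linearMap_qext
    have key : (TensorProduct.rid k (N.M α ⧸ LinearMap.range (φ.φ α))).toLinearMap ∘ₗ
        TensorProduct.map LinearMap.id Cc.ε ∘ₗ
          TensorProduct.map (LinearMap.range (φ.φ α)).mkQ LinearMap.id =
        (LinearMap.range (φ.φ α)).mkQ ∘ₗ (TensorProduct.rid k (N.M α)).toLinearMap ∘ₗ
          TensorProduct.map LinearMap.id Cc.ε := by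
      ext; simp
    have hN := congrArg ((LinearMap.range (φ.φ α)).mkQ ∘ₗ ·) (N.counit α h)
    have e := congrArg (· ∘ₗ N.ρ α 1 h) key
    simp only [LinearMap.comp_assoc, cokerρ_comp_mkQ, LinearMap.comp_id,
      LinearMap.id_comp] at e hN ⊢
    exact e.trans hN
  coassoc δ δ₁ δ₂ α β γ h₁ h₁' h₂ h₂' := by
    apply Submodule.linearMap_qext
    have key : (TensorProduct.assoc k (N.M α ⧸ LinearMap.range (φ.φ α))
          (Cc.C β) (Cc.C γ)).toLinearMap ∘ₗ
        TensorProduct.map (φ.cokerρ α β h₁') LinearMap.id ∘ₗ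
          TensorProduct.map (LinearMap.range (φ.φ δ₁)).mkQ LinearMap.id =
        TensorProduct.map (LinearMap.range (φ.φ α)).mkQ LinearMap.id ∘ₗ
          (TensorProduct.assoc k (N.M α) (Cc.C β) (Cc.C γ)).toLinearMap ∘ₗ
            TensorProduct.map (N.ρ α β h₁') LinearMap.id := by
      rw [← TensorProduct.map_comp, cokerρ_comp_mkQ, LinearMap.id_comp,
        ← LinearMap.id_comp (LinearMap.id : Cc.C γ →ₗ[k] Cc.C γ), TensorProduct.map_comp,
        ← LinearMap.comp_assoc, ← LinearMap.comp_assoc, LinearMap.id_comp]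
      congr 1
      ext; simp
    have key' : TensorProduct.map LinearMap.id (Cc.Δ β γ h₂') ∘ₗ
          TensorProduct.map (LinearMap.range (φ.φ α)).mkQ LinearMap.id =
        TensorProduct.map (LinearMap.range (φ.φ α)).mkQ LinearMap.id ∘ₗ
          TensorProduct.map LinearMap.id (Cc.Δ β γ h₂') := by
      simp only [← TensorProduct.map_comp, LinearMap.id_comp, LinearMap.comp_id]
    have hN := congrArg (TensorProduct.map (LinearMap.range (φ.φ α)).mkQ LinearMap.id ∘ₗ ·)
      (N.coassoc α β γ h₁ h₁' h₂ h₂')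
    have e₁ := congrArg (· ∘ₗ N.ρ δ₁ γ h₁) key
    have e₂ := congrArg (· ∘ₗ N.ρ α δ₂ h₂) key'
    simp only [LinearMap.comp_assoc, cokerρ_comp_mkQ] at e₁ e₂ hN ⊢
    rw [e₁, e₂, hN]

theorem injective_of_injective (hCc : Cc.Strong) (φ : GComodHom M N) {α : G}
    (hα : Function.Injective (φ.φ α)) (γ : G) : Function.Injective (φ.φ γ) := by
  have h : γ = α * (α⁻¹ * γ) := by simp
  have hmap : Function.Injective
      (TensorProduct.map (φ.φ α) (LinearMap.id : Cc.C (α⁻¹ * γ) →ₗ[k] _)) :=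
    Module.Flat.rTensor_preserves_injective_linearMap (M := Cc.C (α⁻¹ * γ)) _ hα
  have hinj := hmap.comp (M.ρ_injective hCc α (α⁻¹ * γ) h)
  rw [← LinearMap.coe_comp, φ.colinear α _ h, LinearMap.coe_comp] at hinj
  exact hinj.of_comp

theorem surjective_of_surjective (hCc : Cc.Strong) (φ : GComodHom M N) {α : G}
    (hα : Function.Surjective (φ.φ α)) (γ : G) : Function.Surjective (φ.φ γ) := by
  have h : γ = α * (α⁻¹ * γ) := by simp
  have : Subsingleton (N.M α ⧸ LinearMap.range (φ.φ α)) :=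
    Submodule.Quotient.subsingleton_iff.mpr (LinearMap.range_eq_top.mpr hα)
  have hinj : Function.Injective (φ.cokerρ α (α⁻¹ * γ) h) :=
    φ.coker.ρ_injective hCc α (α⁻¹ * γ) h
  rw [← LinearMap.range_eq_top, ← Submodule.Quotient.subsingleton_iff]
  exact hinj.subsingleton

end GComodHom

/-- **Corollary 1.5.** Let `C̲` be a strong `G`-coalgebra and `φ̲ : M̲ → N̲` a morphism
of right `G`-`C̲`-comodules. Then `φ_α` is injective (resp. surjective, bijective) for
all `α` iff it is so for some `α`. -/
theorem strong_comodHom_inj_surj_bij_iff (Cc : GCoalgebra k G) (hCc : Cc.Strong)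
    (M N : GComodule Cc) (φ : GComodHom M N) :
    ((∀ α : G, Function.Injective (φ.φ α)) ↔ (∃ α : G, Function.Injective (φ.φ α)))
    ∧ ((∀ α : G, Function.Surjective (φ.φ α)) ↔ (∃ α : G, Function.Surjective (φ.φ α)))
    ∧ ((∀ α : G, Function.Bijective (φ.φ α)) ↔ (∃ α : G, Function.Bijective (φ.φ α))) := by
  refine ⟨⟨fun h => ⟨1, h 1⟩, fun ⟨_, hα⟩ => φ.injective_of_injective hCc hα⟩,
    ⟨fun h => ⟨1, h 1⟩, fun ⟨_, hα⟩ => φ.surjective_of_surjective hCc hα⟩,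
    ⟨fun h => ⟨1, h 1⟩, fun ⟨_, hα⟩ γ => ⟨φ.injective_of_injective hCc hα.1 γ,
      φ.surjective_of_surjective hCc hα.2 γ⟩⟩⟩
end

section
/- Let C̲ be a G-coalgebra and φ̲ : M̲ → N̲ a morphism of right G-C̲-comodules. Setting K_α = Ker(φ_α) and I_α = Im(φ_α), one has ρ^M̲_{α,β}(K_{αβ}) ⊆ K_α ⊗ C_β and ρ^N̲_{α,β}(I_{αβ}) ⊆ I_α ⊗ C_β for all α,β ∈ G; hence the families K̲ = (K_α)_{α∈G} and I̲ = (I_α)_{α∈G} are right G-C̲-comodules with the restricted structure maps, and the category M^{G,C̲} of right G-C̲-comodules is abelian. -/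
open TensorProduct

universe u

variable {k : Type u} [Field k] {G : Type u} [Group G]

theorem GComodHom.ext' {Cc : GCoalgebra k G} {M N : GComodule Cc}
    {f g : GComodHom M N} (h : ∀ α, f.φ α = g.φ α) : f = g := by
  cases f; cases g; congr; funext α; exact h α

/-- The category of right `G`-`C̲`-comodules. -/
instance GComodule.category (Cc : GCoalgebra k G) :
    CategoryTheory.Category (GComodule Cc) where
  Hom M N := GComodHom M N
  id M := ⟨fun _ => LinearMap.id, fun γ α β h => by
    rw [TensorProduct.map_id]; simp⟩
  comp {M N P} f g := ⟨fun α => g.φ α ∘ₗ f.φ α, fun γ α β h => by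
    have hmap : TensorProduct.map (g.φ α ∘ₗ f.φ α)
        (LinearMap.id : Cc.C β →ₗ[k] Cc.C β)
        = TensorProduct.map (g.φ α) LinearMap.id ∘ₗ
            TensorProduct.map (f.φ α) LinearMap.id := by
      rw [← TensorProduct.map_comp]; simp
    rw [hmap, LinearMap.comp_assoc, f.colinear α β h, ← LinearMap.comp_assoc,
      g.colinear α β h, LinearMap.comp_assoc]⟩
  id_comp f := by apply GComodHom.ext'; intro α; simp
  comp_id f := by apply GComodHom.ext'; intro α; simp
  assoc f g h := by apply GComodHom.ext'; intro α; simp [LinearMap.comp_assoc]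

section Naturality

variable {V V₁ V₂ W W₁ W₂ A B D : Type u}
  [AddCommGroup V] [Module k V] [AddCommGroup V₁] [Module k V₁] [AddCommGroup V₂] [Module k V₂]
  [AddCommGroup W] [Module k W] [AddCommGroup W₁] [Module k W₁] [AddCommGroup W₂] [Module k W₂]
  [AddCommGroup A] [Module k A] [AddCommGroup B] [Module k B] [AddCommGroup D] [Module k D]

theorem map_id_comp_map_id (f : V →ₗ[k] V₁) (g : V₁ →ₗ[k] V₂) :
    TensorProduct.map g (LinearMap.id : A →ₗ[k] A) ∘ₗ TensorProduct.map f LinearMap.id =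
      TensorProduct.map (g ∘ₗ f) LinearMap.id := by
  rw [← TensorProduct.map_comp, LinearMap.id_comp]

theorem map_id_injective {f : V →ₗ[k] W} (hf : Function.Injective f) :
    Function.Injective (TensorProduct.map f (LinearMap.id : A →ₗ[k] A)) :=
  Module.Flat.rTensor_preserves_injective_linearMap f hf

theorem exists_comp_eq_of_range_le {i : V →ₗ[k] W} (hi : Function.Injective i) {t : V₁ →ₗ[k] W}
    (ht : LinearMap.range t ≤ LinearMap.range i) : ∃ l : V₁ →ₗ[k] V, i ∘ₗ l = t := by
  obtain ⟨g, hg⟩ := i.exists_leftInverse_of_injective (LinearMap.ker_eq_bot.2 hi)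
  refine ⟨g ∘ₗ t, LinearMap.ext fun x => ?_⟩
  obtain ⟨y, hy⟩ := ht ⟨x, rfl⟩
  rw [LinearMap.comp_apply, LinearMap.comp_apply, ← hy, ← LinearMap.comp_apply g, hg,
    LinearMap.id_apply]

theorem exists_comp_eq_of_ker_le {p : V →ₗ[k] W} (hp : Function.Surjective p) {t : V →ₗ[k] V₁}
    (ht : LinearMap.ker p ≤ LinearMap.ker t) : ∃ l : W →ₗ[k] V₁, l ∘ₗ p = t := by
  obtain ⟨g, hg⟩ := p.exists_rightInverse_of_surjective (LinearMap.range_eq_top.2 hp)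
  refine ⟨t ∘ₗ g, LinearMap.ext fun x => ?_⟩
  have hx : g (p x) - x ∈ LinearMap.ker p := by
    rw [LinearMap.sub_mem_ker_iff, ← LinearMap.comp_apply p, hg, LinearMap.id_apply]
  exact LinearMap.sub_mem_ker_iff.1 (ht hx)

/-- Colinear maps are compatible with contracting a coaction against a functional. -/
theorem counit_naturality (i : V →ₗ[k] W) (e : A →ₗ[k] k) {r : V →ₗ[k] V ⊗[k] A}
    {s : W →ₗ[k] W ⊗[k] A} (h : TensorProduct.map i LinearMap.id ∘ₗ r = s ∘ₗ i) :
    ((TensorProduct.rid k W).toLinearMap ∘ₗ TensorProduct.map LinearMap.id e ∘ₗ s) ∘ₗ i =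
      i ∘ₗ (TensorProduct.rid k V).toLinearMap ∘ₗ TensorProduct.map LinearMap.id e ∘ₗ r := by
  have key : (TensorProduct.rid k W).toLinearMap ∘ₗ TensorProduct.map LinearMap.id e ∘ₗ
      TensorProduct.map i LinearMap.id =
      i ∘ₗ (TensorProduct.rid k V).toLinearMap ∘ₗ TensorProduct.map LinearMap.id e := by
    ext; simp
  rw [LinearMap.comp_assoc, LinearMap.comp_assoc, ← h]
  simpa only [LinearMap.comp_assoc] using congrArg (fun l => l ∘ₗ r) key

/-- Colinear maps are compatible with applying the coaction twice. -/
theorem coaction_coaction_naturality {i : V →ₗ[k] W} {i₁ : V₁ →ₗ[k] W₁} {i₂ : V₂ →ₗ[k] W₂}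
    {r : V →ₗ[k] V₁ ⊗[k] B} {r₁ : V₁ →ₗ[k] V₂ ⊗[k] A}
    {s : W →ₗ[k] W₁ ⊗[k] B} {s₁ : W₁ →ₗ[k] W₂ ⊗[k] A}
    (h : TensorProduct.map i₁ LinearMap.id ∘ₗ r = s ∘ₗ i)
    (h₁ : TensorProduct.map i₂ LinearMap.id ∘ₗ r₁ = s₁ ∘ₗ i₁) :
    ((TensorProduct.assoc k W₂ A B).toLinearMap ∘ₗ
        TensorProduct.map s₁ LinearMap.id ∘ₗ s) ∘ₗ i =
      TensorProduct.map i₂ LinearMap.id ∘ₗ (TensorProduct.assoc k V₂ A B).toLinearMap ∘ₗ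
        TensorProduct.map r₁ LinearMap.id ∘ₗ r := by
  have key : (TensorProduct.assoc k W₂ A B).toLinearMap ∘ₗ
      TensorProduct.map (TensorProduct.map i₂ LinearMap.id) LinearMap.id =
      TensorProduct.map i₂ LinearMap.id ∘ₗ (TensorProduct.assoc k V₂ A B).toLinearMap := by
    ext; simp
  rw [LinearMap.comp_assoc, LinearMap.comp_assoc, ← h,
    ← LinearMap.comp_assoc r (TensorProduct.map i₁ _), map_id_comp_map_id, ← h₁,
    ← map_id_comp_map_id]
  simpa only [LinearMap.comp_assoc] using
    congrArg (fun l => l ∘ₗ TensorProduct.map r₁ LinearMap.id ∘ₗ r) key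

/-- Colinear maps are compatible with a coaction followed by a map on the coefficients. -/
theorem coaction_coefficient_naturality {i : V →ₗ[k] W} {i₁ : V₁ →ₗ[k] W₁} (d : A →ₗ[k] D)
    {r : V →ₗ[k] V₁ ⊗[k] A} {s : W →ₗ[k] W₁ ⊗[k] A}
    (h : TensorProduct.map i₁ LinearMap.id ∘ₗ r = s ∘ₗ i) :
    (TensorProduct.map LinearMap.id d ∘ₗ s) ∘ₗ i =
      TensorProduct.map i₁ LinearMap.id ∘ₗ TensorProduct.map LinearMap.id d ∘ₗ r := by
  rw [LinearMap.comp_assoc, ← h, ← LinearMap.comp_assoc, ← LinearMap.comp_assoc,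
    ← TensorProduct.map_comp, ← TensorProduct.map_comp]
  rfl

end Naturality

namespace GComodule

variable {Cc : GCoalgebra k G}

/-- A family of subspaces stable under the coaction. -/
def IsSubcomodule (N : GComodule Cc) (P : ∀ α, Submodule k (N.M α)) : Prop :=
  ∀ ⦃γ : G⦄ (α β : G) (h : γ = α * β), Submodule.map (N.ρ α β h) (P γ) ≤
    LinearMap.range (TensorProduct.map (P α).subtype (LinearMap.id : Cc.C β →ₗ[k] Cc.C β))

variable {N : GComodule Cc} {P : ∀ α, Submodule k (N.M α)}

theorem IsSubcomodule.exists_coaction (hP : N.IsSubcomodule P) ⦃γ : G⦄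
    (α β : G) (h : γ = α * β) : ∃ r : P γ →ₗ[k] P α ⊗[k] Cc.C β,
      TensorProduct.map (P α).subtype LinearMap.id ∘ₗ r = N.ρ α β h ∘ₗ (P γ).subtype :=
  exists_comp_eq_of_range_le (map_id_injective Subtype.val_injective) <| by
    rw [LinearMap.range_comp, Submodule.range_subtype]
    exact hP α β h

/-- The comodule structure on a stable family of subspaces. -/
noncomputable def sub (N : GComodule Cc) {P : ∀ α, Submodule k (N.M α)}
    (hP : N.IsSubcomodule P) : GComodule Cc where
  M α := P α
  ρ _ α β h := (hP.exists_coaction α β h).choose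
  counit α h := by
    have nat := counit_naturality (P α).subtype Cc.ε (hP.exists_coaction α 1 h).choose_spec
    rw [N.counit α h] at nat
    exact LinearMap.ext fun x => Subtype.ext (LinearMap.congr_fun nat x).symm
  coassoc δ δ₁ δ₂ α β γ h₁ h₁' h₂ h₂' := by
    have nat₁ := coaction_coaction_naturality (hP.exists_coaction δ₁ γ h₁).choose_spec
      (hP.exists_coaction α β h₁').choose_spec
    have nat₂ := coaction_coefficient_naturality (Cc.Δ β γ h₂')
      (hP.exists_coaction α δ₂ h₂).choose_spec
    rw [N.coassoc α β γ h₁ h₁' h₂ h₂', nat₂] at nat₁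
    exact LinearMap.ext fun x => map_id_injective Subtype.val_injective
      (LinearMap.congr_fun nat₁ x).symm

/-- The inclusion of a subcomodule. -/
noncomputable def subι (N : GComodule Cc) {P : ∀ α, Submodule k (N.M α)}
    (hP : N.IsSubcomodule P) : GComodHom (N.sub hP) N where
  φ α := (P α).subtype
  colinear _ α β h := (hP.exists_coaction α β h).choose_spec

/-- The coaction induced on the quotients by a stable family of subspaces. -/
def quotCoaction (hP : N.IsSubcomodule P) ⦃γ : G⦄ (α β : G) (h : γ = α * β) :
    (N.M γ ⧸ P γ) →ₗ[k] (N.M α ⧸ P α) ⊗[k] Cc.C β :=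
  (P γ).liftQ (TensorProduct.map (P α).mkQ LinearMap.id ∘ₗ N.ρ α β h) fun x hx => by
    obtain ⟨y, hy⟩ := hP α β h ⟨x, hx, rfl⟩
    rw [LinearMap.mem_ker, LinearMap.comp_apply, ← hy, ← LinearMap.comp_apply,
      map_id_comp_map_id, (LinearMap.exact_subtype_mkQ (P α)).linearMap_comp_eq_zero,
      TensorProduct.map_zero_left, LinearMap.zero_apply]

theorem quotCoaction_colinear (hP : N.IsSubcomodule P) ⦃γ : G⦄ (α β : G) (h : γ = α * β) :
    TensorProduct.map (P α).mkQ LinearMap.id ∘ₗ N.ρ α β h =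
      quotCoaction hP α β h ∘ₗ (P γ).mkQ :=
  ((P γ).liftQ_mkQ _ _).symm

/-- The comodule structure on the quotients by a stable family of subspaces. -/
def quot (N : GComodule Cc) {P : ∀ α, Submodule k (N.M α)}
    (hP : N.IsSubcomodule P) : GComodule Cc where
  M α := N.M α ⧸ P α
  ρ := quotCoaction hP
  counit α h := by
    have nat := counit_naturality (P α).mkQ Cc.ε (quotCoaction_colinear hP α 1 h)
    rw [N.counit α h] at nat
    exact (P α).linearMap_qext nat
  coassoc δ δ₁ δ₂ α β γ h₁ h₁' h₂ h₂' := by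
    have nat₁ := coaction_coaction_naturality (quotCoaction_colinear hP δ₁ γ h₁)
      (quotCoaction_colinear hP α β h₁')
    have nat₂ := coaction_coefficient_naturality (Cc.Δ β γ h₂')
      (quotCoaction_colinear hP α δ₂ h₂)
    rw [N.coassoc α β γ h₁ h₁' h₂ h₂', ← nat₂] at nat₁
    exact (P δ).linearMap_qext nat₁

/-- The projection onto a quotient comodule. -/
def quotπ (N : GComodule Cc) {P : ∀ α, Submodule k (N.M α)}
    (hP : N.IsSubcomodule P) : GComodHom N (N.quot hP) where
  φ α := (P α).mkQ
  colinear := quotCoaction_colinear hP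

theorem range_subι (N : GComodule Cc) {P : ∀ α, Submodule k (N.M α)} (hP : N.IsSubcomodule P)
    (α : G) : LinearMap.range ((N.subι hP).φ α) = P α :=
  (P α).range_subtype

theorem ker_quotπ (N : GComodule Cc) {P : ∀ α, Submodule k (N.M α)} (hP : N.IsSubcomodule P)
    (α : G) : LinearMap.ker ((N.quotπ hP).φ α) = P α :=
  (P α).ker_mkQ

theorem quotπ_surjective (N : GComodule Cc) {P : ∀ α, Submodule k (N.M α)}
    (hP : N.IsSubcomodule P) (α : G) : Function.Surjective ((N.quotπ hP).φ α) :=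
  (P α).mkQ_surjective

theorem subι_injective (N : GComodule Cc) {P : ∀ α, Submodule k (N.M α)}
    (hP : N.IsSubcomodule P) (α : G) : Function.Injective ((N.subι hP).φ α) :=
  Subtype.val_injective

end GComodule

namespace GComodHom

variable {Cc : GCoalgebra k G} {M N T : GComodule Cc}

theorem colinear_apply (f : GComodHom M N) ⦃γ : G⦄ (α β : G) (h : γ = α * β) (x : M.M γ) :
    TensorProduct.map (f.φ α) LinearMap.id (M.ρ α β h x) = N.ρ α β h (f.φ γ x) :=
  LinearMap.congr_fun (f.colinear α β h) x

theorem isSubcomodule_ker (f : GComodHom M N) :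
    M.IsSubcomodule fun α => LinearMap.ker (f.φ α) := by
  rintro γ α β h _ ⟨x, hx, rfl⟩
  refine (Module.Flat.rTensor_exact (Cc.C β) (f.φ α).exact_subtype_ker_map _).1 ?_
  change TensorProduct.map (f.φ α) LinearMap.id (M.ρ α β h x) = 0
  rw [f.colinear_apply, LinearMap.mem_ker.1 hx, map_zero]

theorem isSubcomodule_range (f : GComodHom M N) :
    N.IsSubcomodule fun α => LinearMap.range (f.φ α) := by
  rintro γ α β h _ ⟨_, ⟨x, rfl⟩, rfl⟩
  refine ⟨TensorProduct.map (f.φ α).rangeRestrict LinearMap.id (M.ρ α β h x), ?_⟩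
  rw [← LinearMap.comp_apply, map_id_comp_map_id, ← f.colinear_apply]
  rfl

/-- Factor a morphism through an injective one with larger range. -/
theorem exists_lift (i : GComodHom M N) (hi : ∀ α, Function.Injective (i.φ α))
    (t : GComodHom T N) (ht : ∀ α, LinearMap.range (t.φ α) ≤ LinearMap.range (i.φ α)) :
    ∃ l : GComodHom T M, ∀ α, i.φ α ∘ₗ l.φ α = t.φ α := by
  choose l hl using fun α => exists_comp_eq_of_range_le (hi α) (ht α)
  refine ⟨⟨l, fun γ α β h => ?_⟩, hl⟩
  rw [← LinearMap.cancel_left (map_id_injective (A := Cc.C β) (hi α)), ← LinearMap.comp_assoc,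
    map_id_comp_map_id, hl, ← LinearMap.comp_assoc, i.colinear, LinearMap.comp_assoc, hl,
    t.colinear]

/-- Factor a morphism through a surjective one with smaller kernel. -/
theorem exists_desc (p : GComodHom M N) (hp : ∀ α, Function.Surjective (p.φ α))
    (t : GComodHom M T) (ht : ∀ α, LinearMap.ker (p.φ α) ≤ LinearMap.ker (t.φ α)) :
    ∃ l : GComodHom N T, ∀ α, l.φ α ∘ₗ p.φ α = t.φ α := by
  choose l hl using fun α => exists_comp_eq_of_ker_le (hp α) (ht α)
  refine ⟨⟨l, fun γ α β h => ?_⟩, hl⟩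
  rw [← LinearMap.cancel_right (hp γ), LinearMap.comp_assoc, ← p.colinear,
    ← LinearMap.comp_assoc, map_id_comp_map_id, hl, LinearMap.comp_assoc, hl, t.colinear]

instance : Zero (GComodHom M N) := ⟨⟨fun _ => 0, fun _ _ _ _ => by simp⟩⟩

instance : Add (GComodHom M N) :=
  ⟨fun f g => ⟨fun α => f.φ α + g.φ α, fun _ α β h => by
    rw [TensorProduct.map_add_left, LinearMap.add_comp, f.colinear, g.colinear,
      LinearMap.comp_add]⟩⟩

instance : Neg (GComodHom M N) :=
  ⟨fun f => ⟨fun α => -f.φ α, fun _ α β h => by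
    rw [← LinearMap.rTensor_def, LinearMap.rTensor_neg, LinearMap.neg_comp, LinearMap.rTensor_def,
      f.colinear, LinearMap.comp_neg]⟩⟩

instance : AddCommGroup (GComodHom M N) where
  add_assoc _ _ _ := ext' fun _ => add_assoc _ _ _
  zero_add _ := ext' fun _ => zero_add _
  add_zero _ := ext' fun _ => add_zero _
  neg_add_cancel _ := ext' fun _ => neg_add_cancel _
  add_comm _ _ := ext' fun _ => add_comm _ _
  nsmul := nsmulRec
  zsmul := zsmulRec

end GComodHom

namespace GComodule

open CategoryTheory CategoryTheory.Limits

variable {Cc : GCoalgebra k G}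

instance : Preadditive (GComodule Cc) where
  homGroup M N := inferInstanceAs (AddCommGroup (GComodHom M N))
  add_comp _ _ _ _ _ _ := GComodHom.ext' fun _ => LinearMap.comp_add _ _ _
  comp_add _ _ _ _ _ _ := GComodHom.ext' fun _ => LinearMap.add_comp _ _ _

theorem comp_eq_zero_iff {M N T : GComodule Cc} {f : M ⟶ N} {g : N ⟶ T} :
    f ≫ g = 0 ↔ ∀ α, LinearMap.range (GComodHom.φ f α) ≤ LinearMap.ker (GComodHom.φ g α) := by
  simp_rw [LinearMap.range_le_ker_iff]
  exact ⟨fun h α => congrArg (fun l : M ⟶ T => GComodHom.φ l α) h, fun h => GComodHom.ext' h⟩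

theorem mono_of_injective {M N : GComodule Cc} (f : M ⟶ N)
    (hf : ∀ α, Function.Injective (GComodHom.φ f α)) : Mono f where
  right_cancellation _ _ h := GComodHom.ext' fun α => (LinearMap.cancel_left (hf α)).1
    (congrArg (fun l => GComodHom.φ l α) h)

theorem epi_of_surjective {M N : GComodule Cc} (f : M ⟶ N)
    (hf : ∀ α, Function.Surjective (GComodHom.φ f α)) : Epi f where
  left_cancellation _ _ h := GComodHom.ext' fun α => (LinearMap.cancel_right (hf α)).1
    (congrArg (fun l => GComodHom.φ l α) h)

/-- An injective morphism onto the kernel of `f` is a kernel of `f`. -/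
noncomputable def isLimitKernelFork {K M N : GComodule Cc} (i : K ⟶ M) (f : M ⟶ N)
    (hi : ∀ α, Function.Injective (GComodHom.φ i α))
    (h : ∀ α, LinearMap.range (GComodHom.φ i α) = LinearMap.ker (GComodHom.φ f α)) :
    IsLimit (KernelFork.ofι i (comp_eq_zero_iff.2 fun α => (h α).le)) :=
  haveI := mono_of_injective i hi
  KernelFork.IsLimit.ofι' i _ fun t ht =>
    have ex := GComodHom.exists_lift i hi t fun α => (h α).symm ▸ comp_eq_zero_iff.1 ht α
    ⟨ex.choose, GComodHom.ext' ex.choose_spec⟩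

/-- A surjective morphism whose kernel is the image of `f` is a cokernel of `f`. -/
noncomputable def isColimitCokernelCofork {M N Q : GComodule Cc} (f : M ⟶ N) (p : N ⟶ Q)
    (hp : ∀ α, Function.Surjective (GComodHom.φ p α))
    (h : ∀ α, LinearMap.range (GComodHom.φ f α) = LinearMap.ker (GComodHom.φ p α)) :
    IsColimit (CokernelCofork.ofπ p (comp_eq_zero_iff.2 fun α => (h α).le)) :=
  haveI := epi_of_surjective p hp
  CokernelCofork.IsColimit.ofπ' p _ fun t ht =>
    have ex := GComodHom.exists_desc p hp t fun α => h α ▸ comp_eq_zero_iff.1 ht α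
    ⟨ex.choose, GComodHom.ext' ex.choose_spec⟩

theorem injective_of_mono {M N : GComodule Cc} (f : M ⟶ N) [Mono f] (α : G) :
    Function.Injective (GComodHom.φ f α) := by
  let i : M.sub (GComodHom.isSubcomodule_ker f) ⟶ M := M.subι (GComodHom.isSubcomodule_ker f)
  have hi : i = 0 := zero_of_comp_mono f <|
    comp_eq_zero_iff.2 fun α => (M.range_subι _ α).le
  rw [← LinearMap.ker_eq_bot, ← M.range_subι (GComodHom.isSubcomodule_ker f) α,
    LinearMap.range_eq_bot]
  exact congrArg (fun l => GComodHom.φ l α) hi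

theorem surjective_of_epi {M N : GComodule Cc} (f : M ⟶ N) [Epi f] (α : G) :
    Function.Surjective (GComodHom.φ f α) := by
  let p : N ⟶ N.quot (GComodHom.isSubcomodule_range f) := N.quotπ (GComodHom.isSubcomodule_range f)
  have hp : p = 0 := zero_of_epi_comp f <|
    comp_eq_zero_iff.2 fun α => (N.ker_quotπ (GComodHom.isSubcomodule_range f) α).ge
  rw [← LinearMap.range_eq_top, ← N.ker_quotπ (GComodHom.isSubcomodule_range f) α,
    LinearMap.ker_eq_top]
  exact congrArg (fun l => GComodHom.φ l α) hp

instance : HasKernels (GComodule Cc) where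
  has_limit f := ⟨⟨_, isLimitKernelFork (subι _ (GComodHom.isSubcomodule_ker f)) f
    (subι_injective _ _) (range_subι _ _)⟩⟩

instance : HasCokernels (GComodule Cc) where
  has_colimit f := ⟨⟨_, isColimitCokernelCofork f (quotπ _ (GComodHom.isSubcomodule_range f))
    (quotπ_surjective _ _)
    fun α => (ker_quotπ _ (GComodHom.isSubcomodule_range f) α).symm⟩⟩

instance : IsNormalMonoCategory (GComodule Cc) where
  normalMonoOfMono f _ := ⟨⟨_, quotπ _ (GComodHom.isSubcomodule_range f), _,
    isLimitKernelFork f _ (injective_of_mono f)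
      fun α => (ker_quotπ _ (GComodHom.isSubcomodule_range f) α).symm⟩⟩

instance : IsNormalEpiCategory (GComodule Cc) where
  normalEpiOfEpi f _ := ⟨⟨_, subι _ (GComodHom.isSubcomodule_ker f), _,
    isColimitCokernelCofork _ f (surjective_of_epi f) (range_subι _ _)⟩⟩

/-- The zero comodule. -/
def zero (Cc : GCoalgebra k G) : GComodule Cc where
  M _ := PUnit
  ρ _ _ _ _ := 0
  counit _ _ := Subsingleton.elim _ _
  coassoc _ _ _ _ _ _ _ _ _ _ := by simp

instance : HasZeroObject (GComodule Cc) :=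
  ⟨zero Cc, (IsZero.iff_id_eq_zero _).2 <| GComodHom.ext' fun _ =>
    LinearMap.ext fun _ => Subsingleton.elim (α := PUnit) _ _⟩

section Prod

variable (M N : GComodule Cc)

/-- The coaction on a direct sum. -/
def prodCoaction ⦃γ : G⦄ (α β : G) (h : γ = α * β) :
    M.M γ × N.M γ →ₗ[k] (M.M α × N.M α) ⊗[k] Cc.C β :=
  (TensorProduct.map (LinearMap.inl k _ _) LinearMap.id ∘ₗ M.ρ α β h).coprod
    (TensorProduct.map (LinearMap.inr k _ _) LinearMap.id ∘ₗ N.ρ α β h)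

theorem inl_colinear ⦃γ : G⦄ (α β : G) (h : γ = α * β) :
    TensorProduct.map (LinearMap.inl k _ _) LinearMap.id ∘ₗ M.ρ α β h =
      prodCoaction M N α β h ∘ₗ LinearMap.inl k _ _ :=
  (LinearMap.coprod_inl _ _).symm

theorem inr_colinear ⦃γ : G⦄ (α β : G) (h : γ = α * β) :
    TensorProduct.map (LinearMap.inr k _ _) LinearMap.id ∘ₗ N.ρ α β h =
      prodCoaction M N α β h ∘ₗ LinearMap.inr k _ _ :=
  (LinearMap.coprod_inr _ _).symm

theorem fst_colinear ⦃γ : G⦄ (α β : G) (h : γ = α * β) :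
    TensorProduct.map (LinearMap.fst k _ _) LinearMap.id ∘ₗ prodCoaction M N α β h =
      M.ρ α β h ∘ₗ LinearMap.fst k _ _ := by
  refine LinearMap.prod_ext ?_ ?_ <;> rw [LinearMap.comp_assoc, LinearMap.comp_assoc]
  · rw [← inl_colinear, ← LinearMap.comp_assoc, map_id_comp_map_id]
    simp
  · rw [← inr_colinear, ← LinearMap.comp_assoc, map_id_comp_map_id]
    simp

theorem snd_colinear ⦃γ : G⦄ (α β : G) (h : γ = α * β) :
    TensorProduct.map (LinearMap.snd k _ _) LinearMap.id ∘ₗ prodCoaction M N α β h =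
      N.ρ α β h ∘ₗ LinearMap.snd k _ _ := by
  refine LinearMap.prod_ext ?_ ?_ <;> rw [LinearMap.comp_assoc, LinearMap.comp_assoc]
  · rw [← inl_colinear, ← LinearMap.comp_assoc, map_id_comp_map_id]
    simp
  · rw [← inr_colinear, ← LinearMap.comp_assoc, map_id_comp_map_id]
    simp

/-- The direct sum of two comodules. -/
def prod : GComodule Cc where
  M α := M.M α × N.M α
  ρ := prodCoaction M N
  counit α h := by
    refine LinearMap.prod_ext ?_ ?_
    · rw [counit_naturality _ _ (inl_colinear M N α 1 h), M.counit]; rfl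
    · rw [counit_naturality _ _ (inr_colinear M N α 1 h), N.counit]; rfl
  coassoc δ δ₁ δ₂ α β γ h₁ h₁' h₂ h₂' := by
    refine LinearMap.prod_ext ?_ ?_
    · rw [coaction_coaction_naturality (inl_colinear M N δ₁ γ h₁) (inl_colinear M N α β h₁'),
        coaction_coefficient_naturality _ (inl_colinear M N α δ₂ h₂), M.coassoc]
    · rw [coaction_coaction_naturality (inr_colinear M N δ₁ γ h₁) (inr_colinear M N α β h₁'),
        coaction_coefficient_naturality _ (inr_colinear M N α δ₂ h₂), N.coassoc]

/-- The direct sum of two comodules as a bicone. -/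
def prodBicone : BinaryBicone M N where
  pt := prod M N
  inl := GComodHom.mk (fun _ => LinearMap.inl k _ _) (inl_colinear M N)
  inr := GComodHom.mk (fun _ => LinearMap.inr k _ _) (inr_colinear M N)
  fst := GComodHom.mk (fun _ => LinearMap.fst k _ _) (fst_colinear M N)
  snd := GComodHom.mk (fun _ => LinearMap.snd k _ _) (snd_colinear M N)
  inl_fst := GComodHom.ext' fun _ => LinearMap.fst_comp_inl _ _ _
  inl_snd := GComodHom.ext' fun _ => LinearMap.snd_comp_inl _ _ _
  inr_fst := GComodHom.ext' fun _ => LinearMap.fst_comp_inr _ _ _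
  inr_snd := GComodHom.ext' fun _ => LinearMap.snd_comp_inr _ _ _

end Prod

instance : HasBinaryBiproducts (GComodule Cc) where
  has_binary_biproduct M N := hasBinaryBiproduct_of_total (prodBicone M N) <|
    GComodHom.ext' fun _ => LinearMap.ext fun _ => Prod.fst_add_snd _

/-- The category of comodules over a `G`-coalgebra is abelian. -/
noncomputable instance : Abelian (GComodule Cc) where
  has_finite_products := hasFiniteProducts_of_has_binary_and_terminal

end GComodule

/-- **Lemma 1.6.** Kernels and images of a morphism of right `G`-`C̲`-comodules are
subcomodules, and the category `M^{G,C̲}` is abelian. -/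
theorem gcomodule_kernels_images_and_abelian (Cc : GCoalgebra k G)
    (M N : GComodule Cc) (φ : GComodHom M N) :
    (∀ ⦃γ : G⦄ (α β : G) (h : γ = α * β),
      Submodule.map (M.ρ α β h) (LinearMap.ker (φ.φ γ)) ≤
        LinearMap.range (TensorProduct.map (LinearMap.ker (φ.φ α)).subtype
          (LinearMap.id : Cc.C β →ₗ[k] Cc.C β)))
    ∧ (∀ ⦃γ : G⦄ (α β : G) (h : γ = α * β),
      Submodule.map (N.ρ α β h) (LinearMap.range (φ.φ γ)) ≤
        LinearMap.range (TensorProduct.map (LinearMap.range (φ.φ α)).subtype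
          (LinearMap.id : Cc.C β →ₗ[k] Cc.C β)))
    ∧ (∃ (K : GComodule Cc) (ι : GComodHom K M),
        (∀ α, Function.Injective (ι.φ α)) ∧
        ∀ α, LinearMap.range (ι.φ α) = LinearMap.ker (φ.φ α))
    ∧ (∃ (I : GComodule Cc) (ι : GComodHom I N),
        (∀ α, Function.Injective (ι.φ α)) ∧
        ∀ α, LinearMap.range (ι.φ α) = LinearMap.range (φ.φ α))
    ∧ Nonempty (CategoryTheory.Abelian (GComodule Cc)) := by
  exact ⟨fun _ α β h => φ.isSubcomodule_ker α β h, fun _ α β h => φ.isSubcomodule_range α β h,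
    ⟨M.sub φ.isSubcomodule_ker, M.subι φ.isSubcomodule_ker,
      fun _ => Subtype.val_injective, fun _ => Submodule.range_subtype _⟩,
    ⟨N.sub φ.isSubcomodule_range, N.subι φ.isSubcomodule_range,
      fun _ => Subtype.val_injective, fun _ => Submodule.range_subtype _⟩,
    ⟨inferInstance⟩⟩
end

section
/- Let C̲ be a homogeneously finite G-coalgebra, i.e. every C_α is a finite-dimensional k-vector space. Let R = ⊕_{α∈G} R_α be the G-graded k-algebra with R_α = C*_{α⁻¹}, multiplication (f # g)(c) = f(c_{(2,α⁻¹)}) g(c_{(1,β⁻¹)}) for f ∈ R_α, g ∈ R_β, c ∈ C_{β⁻¹α⁻¹} (where Δ_{β⁻¹,α⁻¹}(c) = c_{(1,β⁻¹)} ⊗ c_{(2,α⁻¹)}), and unit ε ∈ R_e. Then C̲ is strong if and only if R is strongly graded, i.e. R_α R_β = R_{αβ} for all α,β ∈ G. -/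
open TensorProduct

universe u

variable {k : Type u} [Field k] {G : Type u} [Group G]

/-- The multiplication of the dual `G`-graded algebra `R = ⊕_α C*_{α⁻¹}`:
for `f ∈ R_α = C*_{α⁻¹}` and `g ∈ R_β = C*_{β⁻¹}`, the product
`(f # g)(c) = f(c_{(2,α⁻¹)}) g(c_{(1,β⁻¹)})` for `c ∈ C_{β⁻¹α⁻¹} = C_{(αβ)⁻¹}`. -/
noncomputable def dualGradedMul (Cc : GCoalgebra k G) (α β : G)
    (f : Module.Dual k (Cc.C α⁻¹)) (g : Module.Dual k (Cc.C β⁻¹)) :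
    Module.Dual k (Cc.C (α * β)⁻¹) :=
  LinearMap.mul' k k ∘ₗ TensorProduct.map g f ∘ₗ Cc.Δ β⁻¹ α⁻¹ (mul_inv_rev α β)

theorem span_dual_comp_eq_top_iff_injective {U A B : Type*} [AddCommGroup U] [Module k U]
    [AddCommGroup A] [Module k A] [AddCommGroup B] [Module k B]
    [FiniteDimensional k A] [FiniteDimensional k B] (δ : U →ₗ[k] A ⊗[k] B) :
    Submodule.span k {h : Module.Dual k U | ∃ (f : Module.Dual k B) (g : Module.Dual k A),
      h = LinearMap.mul' k k ∘ₗ TensorProduct.map g f ∘ₗ δ} = ⊤ ↔ Function.Injective δ := by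
  have hset : {h : Module.Dual k U | ∃ (f : Module.Dual k B) (g : Module.Dual k A),
      h = LinearMap.mul' k k ∘ₗ TensorProduct.map g f ∘ₗ δ} =
      (δ.dualMap ∘ₗ (dualDistribEquiv k A B).toLinearMap) ''
        {t | ∃ (g : Module.Dual k A) (f : Module.Dual k B), g ⊗ₜ[k] f = t} := by
    have key (g : Module.Dual k A) (f : Module.Dual k B) :
        LinearMap.mul' k k ∘ₗ TensorProduct.map g f = dualDistribEquiv k A B (g ⊗ₜ f) :=
      TensorProduct.ext' fun a b => by
        simp [dualDistribEquiv, dualDistribEquivOfBasis]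
    ext h
    constructor
    · rintro ⟨f, g, rfl⟩
      refine ⟨_, ⟨g, f, rfl⟩, ?_⟩
      rw [← LinearMap.comp_assoc, key]
      rfl
    · rintro ⟨_, ⟨g, f, rfl⟩, rfl⟩
      refine ⟨f, g, ?_⟩
      rw [← LinearMap.comp_assoc, key]
      rfl
  rw [hset, Submodule.span_image, span_tmul_eq_top, Submodule.map_top, LinearMap.range_eq_top,
    LinearMap.coe_comp, LinearEquiv.coe_coe, EquivLike.surjective_comp,
    LinearMap.dualMap_surjective_iff]

theorem GCoalgebra.strong_iff_forall_injective (Cc : GCoalgebra k G) :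
    Cc.Strong ↔
      ∀ α β : G, Function.Injective (Cc.Δ β⁻¹ α⁻¹ (mul_inv_rev α β)) := by
  have inj_of_eq {γ γ' α α' β β' : G} (hα : α = α') (hβ : β = β') (h : γ = α * β)
      (h' : γ' = α' * β') (hinj : Function.Injective (Cc.Δ α β h)) :
      Function.Injective (Cc.Δ α' β' h') := by
    subst hα hβ h h'
    exact hinj
  exact ⟨fun H α β => inj_of_eq rfl rfl rfl _ (H β⁻¹ α⁻¹),
    fun H α β => inj_of_eq (inv_inv α) (inv_inv β) _ rfl (H β⁻¹ α⁻¹)⟩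

/-- **Proposition 1.8.** A homogeneously finite `G`-coalgebra `C̲` is strong if and only
if the dual `G`-graded algebra `R = ⊕_α C*_{α⁻¹}` is strongly graded, i.e.
`R_α R_β = R_{αβ}` for all `α, β ∈ G`. -/
theorem strong_iff_dual_strongly_graded (Cc : GCoalgebra k G)
    (hfin : ∀ α : G, FiniteDimensional k (Cc.C α)) :
    Cc.Strong ↔
      ∀ α β : G,
        Submodule.span k {h : Module.Dual k (Cc.C (α * β)⁻¹) |
          ∃ (f : Module.Dual k (Cc.C α⁻¹)) (g : Module.Dual k (Cc.C β⁻¹)),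
            h = dualGradedMul Cc α β f g} = ⊤ := by
  rw [GCoalgebra.strong_iff_forall_injective]
  exact forall₂_congr fun α β =>
    (span_dual_comp_eq_top_iff_injective (Cc.Δ β⁻¹ α⁻¹ (mul_inv_rev α β))).symm
end

section
/- Let C̲ be a G-coalgebra. Define (C̲ ⋊ kG)_α = C_α ⊗ kG for α ∈ G, with k-linear maps Δ_{α,β} : C_{αβ} ⊗ kG → (C_α ⊗ kG) ⊗ (C_β ⊗ kG) given by Δ_{α,β}(c ⊗ σ) = (c_{(1,α)} ⊗ βσ) ⊗ (c_{(2,β)} ⊗ σ) for c ∈ C_{αβ}, σ ∈ G, and ε : C_e ⊗ kG → k given by ε(c ⊗ σ) = ε(c). Then C̲ ⋊ kG is a G-coalgebra (the smash coproduct of C̲ and kG). -/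
open TensorProduct

universe u

variable {k : Type u} [Field k] {G : Type u} [Group G]

/-- The map `kG → kG ⊗ kG`, `σ ↦ βσ ⊗ σ`. -/
noncomputable def smashW (β : G) : (G →₀ k) →ₗ[k] (G →₀ k) ⊗[k] (G →₀ k) :=
  Finsupp.lsum k fun σ => LinearMap.toSpanSingleton k _
    (Finsupp.single (β * σ) (1 : k) ⊗ₜ Finsupp.single σ (1 : k))

/-- The augmentation `kG → k`, `σ ↦ 1`. -/
noncomputable def smashAug : (G →₀ k) →ₗ[k] k :=
  Finsupp.lsum k fun _ => LinearMap.id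

/-- The comultiplication `Δ_{α,β}` of the smash coproduct `C̲ ⋊ kG`:
`Δ_{α,β}(c ⊗ σ) = (c_{(1,α)} ⊗ βσ) ⊗ (c_{(2,β)} ⊗ σ)`. -/
noncomputable def smashΔ (Cc : GCoalgebra k G) ⦃γ : G⦄ (α β : G) (h : γ = α * β) :
    (Cc.C γ ⊗[k] (G →₀ k)) →ₗ[k]
      (Cc.C α ⊗[k] (G →₀ k)) ⊗[k] (Cc.C β ⊗[k] (G →₀ k)) :=
  (TensorProduct.tensorTensorTensorComm k (Cc.C α) (Cc.C β)
      (G →₀ k) (G →₀ k)).toLinearMap ∘ₗ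
    TensorProduct.map (Cc.Δ α β h) (smashW β)

/-- The counit of the smash coproduct: `ε(c ⊗ σ) = ε(c)`. -/
noncomputable def smashε (Cc : GCoalgebra k G) : (Cc.C 1 ⊗[k] (G →₀ k)) →ₗ[k] k :=
  LinearMap.mul' k k ∘ₗ TensorProduct.map Cc.ε smashAug
/-- The map `m ↦ m ⊗ σ`. -/
noncomputable def tmulSingle (k : Type*) [Field k] {H : Type*} (M : Type*) [AddCommGroup M]
    [Module k M] (σ : H) : M →ₗ[k] M ⊗[k] (H →₀ k) :=
  (TensorProduct.mk k M (H →₀ k)).flip (Finsupp.single σ 1)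

@[simp] theorem tmulSingle_apply {H M : Type*} [AddCommGroup M] [Module k M] (σ : H) (m : M) :
    tmulSingle k M σ m = m ⊗ₜ Finsupp.single σ 1 := rfl

/-- Linear maps out of `M ⊗ kG` agree as soon as they agree on every `M ⊗ σ`. -/
theorem linearMap_ext_tmulSingle {H M N : Type*} [AddCommGroup M] [Module k M] [AddCommGroup N]
    [Module k N] {f g : M ⊗[k] (H →₀ k) →ₗ[k] N}
    (h : ∀ σ, f ∘ₗ tmulSingle k M σ = g ∘ₗ tmulSingle k M σ) : f = g := by
  ext m σ
  exact LinearMap.congr_fun (h σ) m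

theorem smashΔ_comp_tmulSingle (Cc : GCoalgebra k G) ⦃γ : G⦄ (α β : G) (h : γ = α * β) (σ : G) :
    smashΔ Cc α β h ∘ₗ tmulSingle k (Cc.C γ) σ =
      TensorProduct.map (tmulSingle k (Cc.C α) (β * σ)) (tmulSingle k (Cc.C β) σ) ∘ₗ
        Cc.Δ α β h := by
  have key : ∀ t : Cc.C α ⊗[k] Cc.C β,
      TensorProduct.tensorTensorTensorComm k (Cc.C α) (Cc.C β) (G →₀ k) (G →₀ k)
        (t ⊗ₜ (Finsupp.single (β * σ) 1 ⊗ₜ Finsupp.single σ 1)) =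
      TensorProduct.map (tmulSingle k (Cc.C α) (β * σ)) (tmulSingle k (Cc.C β) σ) t := by
    intro t
    induction t with
    | zero => simp
    | tmul x y => simp
    | add x y hx hy => rw [TensorProduct.add_tmul, map_add, map_add, hx, hy]
  ext c
  simp [smashΔ, smashW, key]

theorem smashε_comp_tmulSingle (Cc : GCoalgebra k G) (σ : G) :
    smashε Cc ∘ₗ tmulSingle k (Cc.C 1) σ = Cc.ε := by
  ext c
  simp [smashε, smashAug]

/-- **Lemma 2.1.** The smash coproduct `C̲ ⋊ kG`, with components `C_α ⊗ kG`,
comultiplications `Δ_{α,β}(c ⊗ σ) = (c_{(1,α)} ⊗ βσ) ⊗ (c_{(2,β)} ⊗ σ)` and counit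
`ε(c ⊗ σ) = ε(c)`, is a `G`-coalgebra. -/
theorem smash_coproduct_is_GCoalgebra (Cc : GCoalgebra k G) :
    (∀ ⦃δ δ₁ δ₂ : G⦄ (α β γ : G) (h₁ : δ = δ₁ * γ) (h₁' : δ₁ = α * β)
        (h₂ : δ = α * δ₂) (h₂' : δ₂ = β * γ),
      (TensorProduct.assoc k (Cc.C α ⊗[k] (G →₀ k)) (Cc.C β ⊗[k] (G →₀ k))
          (Cc.C γ ⊗[k] (G →₀ k))).toLinearMap ∘ₗ
        (TensorProduct.map (smashΔ Cc α β h₁') LinearMap.id) ∘ₗ smashΔ Cc δ₁ γ h₁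
      = (TensorProduct.map LinearMap.id (smashΔ Cc β γ h₂')) ∘ₗ smashΔ Cc α δ₂ h₂)
    ∧ (∀ (α : G) (h : α = α * 1),
      (TensorProduct.rid k (Cc.C α ⊗[k] (G →₀ k))).toLinearMap ∘ₗ
        (TensorProduct.map LinearMap.id (smashε Cc)) ∘ₗ smashΔ Cc α 1 h = LinearMap.id)
    ∧ (∀ (α : G) (h : α = 1 * α),
      (TensorProduct.lid k (Cc.C α ⊗[k] (G →₀ k))).toLinearMap ∘ₗ
        (TensorProduct.map (smashε Cc) LinearMap.id) ∘ₗ smashΔ Cc 1 α h = LinearMap.id) := by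
  refine ⟨fun δ δ₁ δ₂ α β γ h₁ h₁' h₂ h₂' => ?_, fun α h => ?_, fun α h => ?_⟩ <;>
    refine linearMap_ext_tmulSingle fun σ => ?_
  · have assoc_nat := TensorProduct.map_map_comp_assoc_eq (R := k)
      (tmulSingle k (Cc.C α) (β * (γ * σ))) (tmulSingle k (Cc.C β) (γ * σ))
      (tmulSingle k (Cc.C γ) σ)
    rw [LinearMap.comp_assoc, LinearMap.comp_assoc, LinearMap.comp_assoc,
      smashΔ_comp_tmulSingle, smashΔ_comp_tmulSingle, ← LinearMap.comp_assoc (Cc.Δ δ₁ γ h₁),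
      ← LinearMap.comp_assoc (Cc.Δ α δ₂ h₂), ← TensorProduct.map_comp, ← TensorProduct.map_comp,
      smashΔ_comp_tmulSingle, smashΔ_comp_tmulSingle, LinearMap.id_comp, LinearMap.id_comp,
      show δ₂ * σ = β * (γ * σ) by rw [h₂', mul_assoc],
      ← LinearMap.comp_id (tmulSingle k (Cc.C γ) σ), TensorProduct.map_comp,
      ← LinearMap.comp_id (tmulSingle k (Cc.C α) (β * (γ * σ))), TensorProduct.map_comp,
      LinearMap.comp_id, LinearMap.comp_id, LinearMap.comp_assoc, LinearMap.comp_assoc,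
      ← Cc.coassoc α β γ h₁ h₁' h₂ h₂', ← LinearMap.comp_assoc, ← assoc_nat,
      LinearMap.comp_assoc]
  · rw [LinearMap.comp_assoc, LinearMap.comp_assoc, smashΔ_comp_tmulSingle,
      ← LinearMap.comp_assoc (Cc.Δ α 1 h), ← TensorProduct.map_comp, smashε_comp_tmulSingle,
      one_mul, LinearMap.id_comp]
    have nat : (TensorProduct.rid k (Cc.C α ⊗[k] (G →₀ k))).toLinearMap ∘ₗ
        TensorProduct.map (tmulSingle k (Cc.C α) σ) Cc.ε =
        tmulSingle k (Cc.C α) σ ∘ₗ (TensorProduct.rid k (Cc.C α)).toLinearMap ∘ₗ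
          TensorProduct.map LinearMap.id Cc.ε := by
      ext x y
      simp [TensorProduct.smul_tmul']
    rw [← LinearMap.comp_assoc, nat, LinearMap.comp_assoc, LinearMap.comp_assoc,
      Cc.counit_right, LinearMap.comp_id]
  · rw [LinearMap.comp_assoc, LinearMap.comp_assoc, smashΔ_comp_tmulSingle,
      ← LinearMap.comp_assoc (Cc.Δ 1 α h), ← TensorProduct.map_comp, smashε_comp_tmulSingle,
      LinearMap.id_comp]
    have nat : (TensorProduct.lid k (Cc.C α ⊗[k] (G →₀ k))).toLinearMap ∘ₗ
        TensorProduct.map Cc.ε (tmulSingle k (Cc.C α) σ) =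
        tmulSingle k (Cc.C α) σ ∘ₗ (TensorProduct.lid k (Cc.C α)).toLinearMap ∘ₗ
          TensorProduct.map Cc.ε LinearMap.id := by
      ext x y
      simp [TensorProduct.smul_tmul']
    rw [← LinearMap.comp_assoc, nat, LinearMap.comp_assoc, LinearMap.comp_assoc,
      Cc.counit_left, LinearMap.comp_id]
end
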